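/- arXiv:2008.08295 — 7 statements merged into one kernel-verified Lean document; each statement's English description precedes it below -/
import Mathlib

section
/- Let U : ℝ^d → ℝ be C² and a Morse function satisfying the growth conditions, and let ℓ : ℝ^d → ℝ^d be C¹ with ∇U(x)·ℓ(x) = 0 for all x. Let m be an equilibrium of the dynamical system dx(t) = −(∇U+ℓ)(x(t))dt (equivalently, a critical point of U). Then m is a stable equilibrium — meaning: for every r > 0 there exists ρ > 0 such that every solution x : [0,∞) → ℝ^d of x'(t) = −(∇U+ℓ)(x(t)) with |x(0) − m| < ρ satisfies |x(t) − m| < r for all t ≥ 0 — if and only if m is a local minimum of U. -/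
open Real MeasureTheory Set Filter
open scoped InnerProductSpace BigOperators Topology ENNReal

noncomputable section

/-- `ℝ^d` with the Euclidean structure. -/
abbrev Euc (d : ℕ) := EuclideanSpace ℝ (Fin d)

/-- The Laplacian `Δ f`. -/
def lap {d : ℕ} (f : Euc d → ℝ) (x : Euc d) : ℝ :=
  ∑ i, fderiv ℝ (fun y => fderiv ℝ f y (EuclideanSpace.single i 1)) x (EuclideanSpace.single i 1)

/-- The divergence `∇ · F` of a vector field. -/
def vdiv {d : ℕ} (F : Euc d → Euc d) (x : Euc d) : ℝ :=
  ∑ i, fderiv ℝ (fun y => F y i) x (EuclideanSpace.single i 1)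

/-- The growth conditions (1.5) on the potential `U`. -/
def GrowthConditions {d : ℕ} (U : Euc d → ℝ) : Prop :=
  (∀ C : ℝ, ∃ R : ℝ, ∀ x : Euc d, R ≤ ‖x‖ → C ≤ U x / ‖x‖) ∧
  (∀ C : ℝ, ∃ R : ℝ, ∀ x : Euc d, R ≤ ‖x‖ → C ≤ ⟪x, gradient U x⟫_ℝ / ‖x‖) ∧
  (∀ C : ℝ, ∃ R : ℝ, ∀ x : Euc d, R ≤ ‖x‖ → C ≤ ‖gradient U x‖ - 2 * lap U x)

/-- `U` is a Morse function: every critical point is nondegenerate, i.e. the Hessian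
(the derivative of the gradient field) is invertible there. -/
def IsMorse {d : ℕ} (U : Euc d → ℝ) : Prop :=
  ∀ x, gradient U x = 0 → Function.Bijective (fderiv ℝ (gradient U) x)

/-- Determinant of the Hessian `∇²U(m)`. -/
def detHess {d : ℕ} (U : Euc d → ℝ) (m : Euc d) : ℝ :=
  LinearMap.det (fderiv ℝ (gradient U) m).toLinearMap

/-- The generator `𝓛_ε f = -(∇U + ℓ)·∇f + ε Δf`. -/
def gen {d : ℕ} (U : Euc d → ℝ) (ℓ : Euc d → Euc d) (ε : ℝ) (f : Euc d → ℝ) (x : Euc d) : ℝ :=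
  - ⟪gradient U x + ℓ x, gradient f x⟫_ℝ + ε * lap f x

/-- The Gibbs measure `μ_ε(dx) = Z_ε⁻¹ e^{-U(x)/ε} dx`. -/
def gibbs {d : ℕ} (U : Euc d → ℝ) (ε : ℝ) : Measure (Euc d) :=
  (ENNReal.ofReal (∫ x : Euc d, Real.exp (-U x / ε)))⁻¹ •
    (volume.withDensity fun x => ENNReal.ofReal (Real.exp (-U x / ε)))

/-- A bounded Lipschitz vector field has a forward solution for all times from every point. -/
theorem exists_forward_solution_of_lipschitzWith {E : Type*} [NormedAddCommGroup E]
    [NormedSpace ℝ E] [CompleteSpace E] {V : E → E} {K : NNReal} (hK : LipschitzWith K V)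
    {L : ℝ} (hL : ∀ x, ‖V x‖ ≤ L) (x₀ : E) :
    ∃ x : ℝ → E, x 0 = x₀ ∧ ∀ t ∈ Ici (0 : ℝ), HasDerivWithinAt x (V (x t)) (Ici 0) t := by
  have hL₀ : 0 ≤ L := (norm_nonneg _).trans (hL x₀)
  have hloc : ∀ T : ℝ, 0 < T → ∃ α : ℝ → E, α 0 = x₀ ∧
      ∀ t ∈ Icc 0 T, HasDerivWithinAt α (V (α t)) (Icc 0 T) t := by
    intro T hT
    have hpl : IsPicardLindelof (fun _ => V) (tmin := 0) (tmax := T) ⟨0, by simp [hT.le]⟩ x₀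
        (L.toNNReal * T.toNNReal) 0 L.toNNReal K :=
      { lipschitzOnWith := fun _ _ => hK.lipschitzOnWith
        continuousOn := fun _ _ => continuousOn_const
        norm_le := fun _ _ x _ => by simpa [hL₀] using hL x
        mul_max_le := by simp [hT.le, hL₀] }
    exact hpl.exists_eq_forall_mem_Icc_hasDerivWithinAt₀
  choose! α hα₀ hα using hloc
  have huniq : ∀ S T : ℝ, 0 < S → S ≤ T → EqOn (α S) (α T) (Icc 0 S) := by
    intro S T hS hST
    have hright : ∀ T', S ≤ T' → ∀ t ∈ Ico 0 S,
        HasDerivWithinAt (α T') (V (α T' t)) (Ici t) t := fun T' hT' t ht =>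
      (hα T' (hS.trans_le hT') t ⟨ht.1, ht.2.le.trans hT'⟩).mono_of_mem_nhdsWithin
        (mem_of_superset (Icc_mem_nhdsGE (ht.2.trans_le hT')) (Icc_subset_Icc_left ht.1))
    have hcont : ∀ T', S ≤ T' → ContinuousOn (α T') (Icc 0 S) := fun T' hT' t ht =>
      (hα T' (hS.trans_le hT') t ⟨ht.1, ht.2.trans hT'⟩).continuousWithinAt.mono
        (Icc_subset_Icc_right hT')
    exact ODE_solution_unique (v := fun _ => V) (fun _ => hK) (hcont S le_rfl) (hright S le_rfl)
      (hcont T hST) (hright T hST) ((hα₀ S hS).trans (hα₀ T (hS.trans_le hST)).symm)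
  refine ⟨fun t => α (t + 1) t, by simpa using hα₀ 1 one_pos, fun t ht => ?_⟩
  have ht : 0 ≤ t := ht
  have heq : ∀ s ∈ Icc 0 (t + 1), α (s + 1) s = α (t + 1) s := by
    intro s hs
    rcases le_total s t with h | h
    · exact huniq (s + 1) (t + 1) (by linarith [hs.1]) (by linarith) ⟨hs.1, by linarith⟩
    · exact (huniq (t + 1) (s + 1) (by linarith) (by linarith) hs).symm
  have hmem : t ∈ Icc 0 (t + 1) := ⟨ht, by linarith⟩
  have hnhds : Icc 0 (t + 1) ∈ 𝓝[Ici 0] t := by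
    rw [← Ici_inter_Iic]
    exact inter_mem self_mem_nhdsWithin (mem_nhdsWithin_of_mem_nhds (Iic_mem_nhds (by linarith)))
  exact ((hα (t + 1) (by linarith) t hmem).congr_of_mem heq hmem).mono_of_mem_nhdsWithin hnhds

/-- If `U` decreases at rate at least `c` along a forward solution, then it decreases at least
linearly in time. -/
theorem le_sub_mul_of_forward_solution {E : Type*} [NormedAddCommGroup E] [NormedSpace ℝ E]
    {U : E → ℝ} (hU : Differentiable ℝ U) {V : E → E} {x : ℝ → E}
    (hx : ∀ t ∈ Ici (0 : ℝ), HasDerivWithinAt x (V (x t)) (Ici 0) t) {c : ℝ}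
    (hc : ∀ t ∈ Ici (0 : ℝ), fderiv ℝ U (x t) (V (x t)) ≤ -c) {t : ℝ} (ht : 0 ≤ t) :
    U (x t) ≤ U (x 0) - c * t := by
  have hd : ∀ s ∈ Ici (0 : ℝ),
      HasDerivWithinAt (fun s => U (x s)) (fderiv ℝ U (x s) (V (x s))) (Ici 0) s :=
    fun s hs => (hU (x s)).hasFDerivAt.comp_hasDerivWithinAt s (hx s hs)
  have hd' : ∀ s ∈ interior (Ici (0 : ℝ)),
      HasDerivAt (fun s => U (x s)) (fderiv ℝ U (x s) (V (x s))) s := fun s hs =>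
    (hd s (interior_subset hs)).hasDerivAt (mem_interior_iff_mem_nhds.1 hs)
  have := (convex_Ici (0 : ℝ)).image_sub_le_mul_sub_of_deriv_le
    (f := fun s => U (x s)) (fun s hs => (hd s hs).continuousWithinAt)
    (fun s hs => (hd' s hs).differentiableAt.differentiableWithinAt)
    (fun s hs => (hd' s hs).deriv.trans_le (hc s (interior_subset hs)))
    0 self_mem_Ici t ht ht
  linarith

/-- A `C¹` vector field admitting a Lyapunov function with bounded sublevel sets has a forward
solution for all times from every point. -/
theorem exists_forward_solution_of_lyapunov {E : Type*} [NormedAddCommGroup E] [NormedSpace ℝ E]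
    [FiniteDimensional ℝ E] {U : E → ℝ} (hU : Differentiable ℝ U) {V : E → E}
    (hV : ContDiff ℝ 1 V) (hUV : ∀ x, fderiv ℝ U x (V x) ≤ 0)
    (hbdd : ∀ a, ∃ R, ∀ x, U x ≤ a → ‖x‖ ≤ R) (x₀ : E) :
    ∃ x : ℝ → E, x 0 = x₀ ∧ ∀ t ∈ Ici (0 : ℝ), HasDerivWithinAt x (V (x t)) (Ici 0) t := by
  have := FiniteDimensional.complete ℝ E
  obtain ⟨R, hR⟩ := hbdd (U x₀)
  let χ : ContDiffBump (0 : E) := ⟨max R 1, max R 1 + 1, by positivity, by linarith⟩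
  have hsupp : HasCompactSupport fun x => χ x • V x := χ.hasCompactSupport.smul_right
  have hW : ContDiff ℝ 1 fun x => χ x • V x := χ.contDiff.smul hV
  obtain ⟨K, hK⟩ := hW.lipschitzWith_of_hasCompactSupport hsupp one_ne_zero
  obtain ⟨L, hL⟩ := hsupp.exists_bound_of_continuous hW.continuous
  obtain ⟨x, hx₀, hx⟩ := exists_forward_solution_of_lipschitzWith hK hL x₀
  refine ⟨x, hx₀, fun t ht => ?_⟩
  have hle := le_sub_mul_of_forward_solution hU (V := fun x => χ x • V x) hx (c := 0) (fun s _ => by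
    simpa using mul_nonpos_of_nonneg_of_nonpos χ.nonneg (hUV (x s))) ht
  have hone : χ (x t) = 1 := χ.one_of_mem_closedBall <| mem_closedBall_zero_iff.2 <|
    (hR _ (by simpa [hx₀] using hle)).trans (le_max_left _ _)
  simpa [hone] using hx t ht

/-- An isolated critical point that is a local minimum is Lyapunov stable. -/
theorem stable_of_isLocalMin {E : Type*} [NormedAddCommGroup E] [NormedSpace ℝ E]
    [FiniteDimensional ℝ E] {U : E → ℝ} (hU : Differentiable ℝ U) {V : E → E}
    (hUV : ∀ x, fderiv ℝ U x (V x) ≤ 0) {m : E}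
    (hiso : ∀ᶠ x in 𝓝[≠] m, fderiv ℝ U x ≠ 0) (hmin : IsLocalMin U m) {r : ℝ} (hr : 0 < r) :
    ∃ ρ > (0 : ℝ), ∀ x : ℝ → E,
      (∀ t ∈ Ici (0 : ℝ), HasDerivWithinAt x (V (x t)) (Ici 0) t) →
      ‖x 0 - m‖ < ρ → ∀ t ≥ (0 : ℝ), ‖x t - m‖ < r := by
  obtain ⟨δ, hδ, hball⟩ := Metric.eventually_nhds_iff.1
    (hmin.and (eventually_nhdsWithin_iff.1 hiso))
  obtain ⟨s, hs, hsr, hsδ⟩ : ∃ s, 0 < s ∧ s ≤ r ∧ s < δ :=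
    ⟨min r (δ / 2), lt_min hr (half_pos hδ), min_le_left _ _,
      (min_le_right _ _).trans_lt (half_lt_self hδ)⟩
  have hstrict : ∀ y ∈ Metric.sphere m s, U m < U y := by
    intro y hy
    have hyδ : dist y m < δ := (Metric.mem_sphere.1 hy).trans_lt hsδ
    refine lt_of_le_of_ne (hball hyδ).1 fun heq => ?_
    have hymin : IsLocalMin U y := by
      filter_upwards [Metric.isOpen_ball.mem_nhds (Metric.mem_ball.2 hyδ)] with z hz
      exact heq ▸ (hball hz).1
    exact (hball hyδ).2 (Metric.ne_of_mem_sphere hy hs.ne') hymin.fderiv_eq_zero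
  obtain ⟨a, ha, hsphere⟩ : ∃ a, U m < a ∧ ∀ y ∈ Metric.sphere m s, a ≤ U y := by
    rcases (Metric.sphere m s).eq_empty_or_nonempty with h | h
    · exact ⟨U m + 1, by linarith, by simp [h]⟩
    · obtain ⟨y, hy, hymin⟩ := (isCompact_sphere m s).exists_isMinOn h hU.continuous.continuousOn
      exact ⟨U y, hstrict y hy, hymin⟩
  obtain ⟨ρ, hρ, hρa⟩ := Metric.eventually_nhds_iff.1
    (hU.continuous.continuousAt.eventually_lt_const ha)
  refine ⟨min ρ s, lt_min hρ hs, fun x hx hx₀ t ht => ?_⟩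
  by_contra! hfar
  have hcont : ContinuousOn (fun t => ‖x t - m‖) (Icc 0 t) := fun u hu =>
    ((hx u hu.1).continuousWithinAt.mono Icc_subset_Ici_self).sub continuousWithinAt_const |>.norm
  obtain ⟨u, hu, hus⟩ := intermediate_value_Icc ht hcont
    ⟨(hx₀.trans_le (min_le_right _ _)).le, hsr.trans hfar⟩
  have hdec := le_sub_mul_of_forward_solution hU hx (c := 0) (fun s _ => by simpa using hUV (x s))
    hu.1
  have hlow := hsphere (x u) (by simpa [dist_eq_norm] using hus)
  have hinit : U (x 0) < a := hρa (by
    simpa [dist_eq_norm] using hx₀.trans_le (min_le_left _ _))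
  linarith

/-- A Lyapunov stable point that is isolated among the points where `U` is stationary along the
vector field is a local minimum of `U`. -/
theorem isLocalMin_of_stable {E : Type*} [NormedAddCommGroup E] [NormedSpace ℝ E]
    [FiniteDimensional ℝ E] {U : E → ℝ} (hU : ContDiff ℝ 1 U) {V : E → E}
    (hV : ContDiff ℝ 1 V) (hUV : ∀ x, fderiv ℝ U x (V x) ≤ 0)
    (hbdd : ∀ a, ∃ R, ∀ x, U x ≤ a → ‖x‖ ≤ R) {m : E}
    (hiso : ∀ᶠ x in 𝓝[≠] m, fderiv ℝ U x (V x) ≠ 0)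
    (hstable : ∀ r > (0 : ℝ), ∃ ρ > (0 : ℝ), ∀ x : ℝ → E,
      (∀ t ∈ Ici (0 : ℝ), HasDerivWithinAt x (V (x t)) (Ici 0) t) →
      ‖x 0 - m‖ < ρ → ∀ t ≥ (0 : ℝ), ‖x t - m‖ < r) :
    IsLocalMin U m := by
  have hUd : Differentiable ℝ U := hU.differentiable one_ne_zero
  obtain ⟨δ, hδ, hball⟩ := Metric.eventually_nhds_iff.1 (eventually_nhdsWithin_iff.1 hiso)
  obtain ⟨ρ, hρ, hstay⟩ := hstable (δ / 2) (half_pos hδ)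
  refine Metric.eventually_nhds_iff.2 ⟨ρ, hρ, fun y hy => ?_⟩
  by_contra! hlt
  obtain ⟨x, hx₀, hx⟩ := exists_forward_solution_of_lyapunov hUd hV hUV hbdd y
  have hnear := hstay x hx (by simpa [hx₀, dist_eq_norm] using hy)
  have hdec : ∀ t ≥ (0 : ℝ), U (x t) ≤ U y := fun t ht => by
    simpa [hx₀] using le_sub_mul_of_forward_solution hUd hx (c := 0)
      (fun s _ => by simpa using hUV (x s)) ht
  let S := Metric.closedBall m (δ / 2) ∩ {z | U z ≤ U y}
  have hS : IsCompact S := (isCompact_closedBall m (δ / 2)).inter_right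
    (isClosed_le hU.continuous continuous_const)
  have hxS : ∀ t ≥ (0 : ℝ), x t ∈ S := fun t ht =>
    ⟨by simpa [dist_eq_norm] using (hnear t ht).le, hdec t ht⟩
  have hne : S.Nonempty := ⟨x 0, hxS 0 le_rfl⟩
  have hcont : Continuous fun z => fderiv ℝ U z (V z) :=
    (hU.continuous_fderiv one_ne_zero).clm_apply hV.continuous
  obtain ⟨p, hp, hpmax⟩ := hS.exists_isMaxOn hne hcont.continuousOn
  obtain ⟨q, -, hqmin⟩ := hS.exists_isMinOn hne hU.continuous.continuousOn
  have hneg : fderiv ℝ U p (V p) < 0 := by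
    refine lt_of_le_of_ne (hUV p) (hball ?_ ?_)
    · exact (Metric.mem_closedBall.1 hp.1).trans_lt (half_lt_self hδ)
    · rintro rfl
      exact hlt.not_ge hp.2
  obtain ⟨n, hn⟩ := exists_nat_gt ((U y - U q) / -fderiv ℝ U p (V p))
  have hlin := le_sub_mul_of_forward_solution hUd hx (c := -fderiv ℝ U p (V p))
    (fun s hs => by simpa using hpmax (hxS s hs)) n.cast_nonneg
  have hlow : U q ≤ U (x n) := hqmin (hxS n n.cast_nonneg)
  rw [div_lt_iff₀ (by linarith)] at hn
  rw [hx₀] at hlin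
  linarith

/-- Superlinear growth makes sublevel sets bounded. -/
theorem GrowthConditions.exists_norm_le_of_le {d : ℕ} {U : Euc d → ℝ} (h : GrowthConditions U)
    (a : ℝ) : ∃ R, ∀ x, U x ≤ a → ‖x‖ ≤ R := by
  obtain ⟨R, hR⟩ := h.1 1
  refine ⟨max R a, fun x hx => ?_⟩
  by_contra! hlt
  have hquot := hR x ((le_max_left _ _).trans hlt.le)
  have hpos : 0 < ‖x‖ := (norm_nonneg x).lt_of_ne fun h0 => by
    rw [← h0, div_zero] at hquot
    exact absurd hquot (by norm_num)
  rw [le_div_iff₀ hpos] at hquot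
  linarith [le_max_right R a]

theorem contDiff_gradient {d : ℕ} {U : Euc d → ℝ} (hU : ContDiff ℝ 2 U) :
    ContDiff ℝ 1 (gradient U) :=
  (InnerProductSpace.toDual ℝ (Euc d)).symm.contDiff.comp
    (hU.fderiv_right (m := 1) (by norm_num))

/-- Critical points of a `C²` Morse function are isolated. -/
theorem IsMorse.eventually_gradient_ne_zero {d : ℕ} {U : Euc d → ℝ} (hM : IsMorse U)
    (hU : ContDiff ℝ 2 U) {m : Euc d} (hm : gradient U m = 0) :
    ∀ᶠ x in 𝓝[≠] m, gradient U x ≠ 0 :=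
  ((contDiff_gradient hU).differentiable one_ne_zero m).hasFDerivAt.eventually_ne
    (LinearMap.exists_antilipschitzWith _ (LinearMap.ker_eq_bot.2 (hM m hm).1) |>.imp
      fun _ h => h.2)

/-- Theorem 2.1 of the paper, second part: an equilibrium `m` of the dynamical
system `dx = -(∇U + ℓ)(x) dt` is stable (in the Lyapunov sense spelled out below) if and only if
`m` is a local minimum of `U`. -/
theorem stable_iff_localMin {d : ℕ} (U : Euc d → ℝ) (ℓ : Euc d → Euc d)
    (hU : ContDiff ℝ 2 U) (hMorse : IsMorse U) (hGrowth : GrowthConditions U)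
    (hℓ : ContDiff ℝ 1 ℓ) (horth : ∀ x : Euc d, ⟪gradient U x, ℓ x⟫_ℝ = 0)
    (m : Euc d) (hm : gradient U m + ℓ m = 0) :
    (∀ r > (0 : ℝ), ∃ ρ > (0 : ℝ), ∀ x : ℝ → Euc d,
        (∀ t ∈ Set.Ici (0 : ℝ),
          HasDerivWithinAt x (-(gradient U (x t) + ℓ (x t))) (Set.Ici 0) t) →
        ‖x 0 - m‖ < ρ → ∀ t ≥ (0 : ℝ), ‖x t - m‖ < r)
    ↔ IsLocalMin U m := by
  have hUV : ∀ x, fderiv ℝ U x (-(gradient U x + ℓ x)) = -‖gradient U x‖ ^ 2 := fun x => by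
    rw [← inner_gradient_left, inner_neg_right, inner_add_right, horth x, add_zero,
      real_inner_self_eq_norm_sq]
  have hUV' : ∀ x, fderiv ℝ U x (-(gradient U x + ℓ x)) ≤ 0 := fun x => by
    rw [hUV x, neg_nonpos]
    positivity
  have hcrit : gradient U m = 0 := by
    have h := hUV m
    rw [hm, neg_zero, map_zero] at h
    simpa using h.symm
  have hiso := hMorse.eventually_gradient_ne_zero hU hcrit
  constructor
  · refine isLocalMin_of_stable (hU.of_le one_le_two)
      ((contDiff_gradient hU).add hℓ).neg hUV' hGrowth.exists_norm_le_of_le ?_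
    filter_upwards [hiso] with x hx
    rw [hUV x]
    simpa using hx
  · intro hmin r hr
    refine stable_of_isLocalMin (hU.differentiable two_ne_zero) hUV' ?_ hmin hr
    filter_upwards [hiso] with x hx h0
    exact hx (by simp [gradient, h0])
end
end

section
/- Let U : ℝ^d → ℝ be C² and b : ℝ^d → ℝ^d be C¹. Then the following are equivalent: (i) for every ε > 0 the Gibbs density e^{−U/ε} is a stationary solution of the Fokker–Planck equation of the diffusion dz_ε(t) = −b(z_ε(t))dt + √(2ε)dw_t, i.e. ε Δ(e^{−U(x)/ε}) + ∇·( e^{−U(x)/ε} b(x) ) = 0 for all x ∈ ℝ^d and all ε > 0 (equivalently, the Gibbs measure μ_ε is invariant for the diffusion); (ii) the vector field ℓ := b − ∇U satisfies ∇U(x)·ℓ(x) = 0 and (∇·ℓ)(x) = 0 for all x ∈ ℝ^d. -/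
open Real MeasureTheory Set Filter
open scoped InnerProductSpace BigOperators Topology ENNReal

noncomputable section

theorem gradient_apply_eq_fderiv_single {d : ℕ} (U : Euc d → ℝ) (x : Euc d) (i : Fin d) :
    gradient U x i = fderiv ℝ U x (EuclideanSpace.single i 1) := by
  have h := InnerProductSpace.toDual_symm_apply (𝕜 := ℝ) (x := EuclideanSpace.single i (1 : ℝ))
    (y := fderiv ℝ U x)
  rw [EuclideanSpace.inner_single_right] at h
  simpa [gradient] using h

theorem fderiv_exp_neg_div {E : Type*} [NormedAddCommGroup E] [NormedSpace ℝ E] {U : E → ℝ}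
    {x : E} (hU : DifferentiableAt ℝ U x) (ε : ℝ) (v : E) :
    fderiv ℝ (fun y => Real.exp (-U y / ε)) x v
      = -ε⁻¹ * (Real.exp (-U x / ε) * fderiv ℝ U x v) := by
  have h : HasFDerivAt (fun y => Real.exp (-U y / ε))
      (Real.exp (-U x / ε) • ε⁻¹ • -fderiv ℝ U x) x := by
    simpa only [div_eq_mul_inv, Pi.neg_apply] using (hU.hasFDerivAt.neg.mul_const ε⁻¹).exp
  rw [h.fderiv]
  simp only [smul_apply, neg_apply, smul_eq_mul]
  ring

/-- The Fokker--Planck operator applied to the Gibbs density, in terms of the field `b - ∇U`. -/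
theorem fokkerPlanck_gibbs_density {d : ℕ} {U : Euc d → ℝ} {b : Euc d → Euc d}
    (hU : ContDiff ℝ 2 U) (hb : ContDiff ℝ 1 b) {ε : ℝ} (hε : ε ≠ 0) (x : Euc d) :
    ε * lap (fun y => Real.exp (-U y / ε)) x + vdiv (fun y => Real.exp (-U y / ε) • b y) x
      = Real.exp (-U x / ε) * (vdiv (fun y => b y - gradient U y) x
          - ε⁻¹ * ⟪gradient U x, b x - gradient U x⟫_ℝ) := by
  have hUd : Differentiable ℝ U := hU.differentiable (by norm_num)
  have hbd : Differentiable ℝ b := hb.differentiable (by norm_num)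
  have hexp : Differentiable ℝ (fun y => Real.exp (-U y / ε)) := by fun_prop
  have hdU : Differentiable ℝ (fderiv ℝ U) :=
    (hU.fderiv_right (m := 1) (by norm_num)).differentiable (by norm_num)
  simp only [lap, vdiv, PiLp.inner_apply, Finset.mul_sum, ← Finset.sum_add_distrib,
    ← Finset.sum_sub_distrib]
  refine Finset.sum_congr rfl fun i _ => ?_
  have hbi : Differentiable ℝ (fun y => b y i) := by fun_prop
  have hUi : Differentiable ℝ (fun y => fderiv ℝ U y (EuclideanSpace.single i 1)) := by fun_prop
  simp only [fderiv_exp_neg_div (hUd _), PiLp.sub_apply, PiLp.smul_apply, smul_eq_mul,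
    gradient_apply_eq_fderiv_single]
  rw [fderiv_const_mul ((hexp x).fun_mul (hUi x)), fderiv_fun_mul (hexp x) (hUi x),
    fderiv_fun_mul (hexp x) (hbi x), fderiv_fun_sub (hbi x) (hUi x)]
  simp only [smul_apply, add_apply,
    sub_apply, smul_eq_mul, fderiv_exp_neg_div (hUd x), RCLike.inner_apply, conj_trivial]
  field_simp
  ring

/-- Theorem 2.3 of the paper: the Gibbs density `e^{-U/ε}` is a stationary
solution of the Fokker--Planck equation of `dz = -b(z)dt + √(2ε)dw` for every `ε > 0` iff
`ℓ := b - ∇U` is orthogonal to `∇U` and divergence free. -/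
theorem gibbs_invariant_iff {d : ℕ} (U : Euc d → ℝ) (b : Euc d → Euc d)
    (hU : ContDiff ℝ 2 U) (hb : ContDiff ℝ 1 b) :
    (∀ ε : ℝ, 0 < ε → ∀ x : Euc d,
        ε * lap (fun y => Real.exp (-U y / ε)) x
          + vdiv (fun y => Real.exp (-U y / ε) • b y) x = 0)
    ↔ (∀ x : Euc d,
        ⟪gradient U x, b x - gradient U x⟫_ℝ = 0
          ∧ vdiv (fun y => b y - gradient U y) x = 0) := by
  constructor
  · intro h x
    have h₁ := h 1 one_pos x
    have h₂ := h 2 two_pos x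
    rw [fokkerPlanck_gibbs_density hU hb (by norm_num)] at h₁ h₂
    have h₁' := (mul_eq_zero.mp h₁).resolve_left (Real.exp_ne_zero _)
    have h₂' := (mul_eq_zero.mp h₂).resolve_left (Real.exp_ne_zero _)
    constructor <;> linarith
  · intro h ε hε x
    rw [fokkerPlanck_gibbs_density hU hb hε.ne', (h x).1, (h x).2]
    simp
end
end

section
/- Let U : ℝ^d → ℝ be C², a Morse function, satisfying the growth conditions, with h = min U attained on the finite set M⋆ of global minima, each nondegenerate. Fix r₀ > 0 so small that the closed balls of radius r₀ around the points of M⋆ are pairwise disjoint. Then for every subset A ⊆ M⋆, lim_{ε→0} μ_ε( ⋃_{m∈A} closed ball of radius r₀ around m ) = ( Σ_{m∈A} (det ∇²U(m))^{−1/2} ) / ν⋆, where ν⋆ = Σ_{m∈M⋆} (det ∇²U(m))^{−1/2}; in particular, lim_{ε→0} μ_ε( ℝ^d ∖ ⋃_{m∈M⋆} closed ball of radius r₀ around m ) = 0. -/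
open Real MeasureTheory Set Filter
open scoped InnerProductSpace BigOperators Topology ENNReal

noncomputable section

open scoped MatrixOrder ComplexOrder in
/-- A positive operator has the form `Bᵀ B` for a square operator `B`. -/
lemma exists_inner_eq_norm_sq_and_det_eq_sq {d : ℕ} {H : Euc d →ₗ[ℝ] Euc d} (hH : H.IsPositive) :
    ∃ B : Euc d →ₗ[ℝ] Euc d,
      (∀ y, ⟪H y, y⟫_ℝ = ‖B y‖ ^ 2) ∧ LinearMap.det H = LinearMap.det B ^ 2 := by
  obtain ⟨A, rfl⟩ := (Matrix.toEuclideanLin (𝕜 := ℝ) (m := Fin d) (n := Fin d)).surjective H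
  have hA : A.PosSemidef := Matrix.isPositive_toEuclideanLin_iff.1 hH
  obtain ⟨C, rfl⟩ := CStarAlgebra.nonneg_iff_eq_star_mul_self.1 hA.nonneg
  have hmul : Matrix.toEuclideanLin (star C * C) =
      (LinearMap.adjoint (Matrix.toEuclideanLin C)) ∘ₗ Matrix.toEuclideanLin C := by
    rw [← Matrix.toEuclideanLin_conjTranspose_eq_adjoint]
    ext1 x
    simp [Matrix.toLpLin_apply, Matrix.star_eq_conjTranspose]
  refine ⟨Matrix.toEuclideanLin C, fun y => ?_, ?_⟩
  · rw [hmul, LinearMap.comp_apply, LinearMap.adjoint_inner_left, real_inner_self_eq_norm_sq]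
  · have hdet : ∀ M : Matrix (Fin d) (Fin d) ℝ,
        LinearMap.det (Matrix.toEuclideanLin M) = M.det := fun M => by
      rw [Matrix.toEuclideanLin, Matrix.toLpLin_eq_toLin, LinearMap.det_toLin]
    rw [hdet, hdet, Matrix.det_mul, Matrix.star_eq_conjTranspose, Matrix.det_conjTranspose]
    simp [sq]

section Gaussian

variable {d : ℕ}

lemma integrable_exp_neg_mul_norm_sq {c : ℝ} (hc : 0 < c) :
    Integrable fun x : Euc d => Real.exp (-c * ‖x‖ ^ 2) := by
  refine .of_integral_ne_zero ?_
  rw [GaussianFourier.integral_rexp_neg_mul_sq_norm hc]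
  positivity

lemma integral_exp_neg_half_norm_sq_pos :
    0 < ∫ x : Euc d, Real.exp (-(1 / 2) * ‖x‖ ^ 2) := by
  rw [GaussianFourier.integral_rexp_neg_mul_sq_norm (by norm_num)]
  positivity

/-- Linear change of variables for an integral over the whole space. -/
lemma integral_comp_linearMap {B : Euc d →ₗ[ℝ] Euc d} (hB : LinearMap.det B ≠ 0)
    {g : Euc d → ℝ} (hg : Continuous g) :
    ∫ x, g (B x) = |LinearMap.det B|⁻¹ * ∫ x, g x := by
  have hmap := Measure.map_linearMap_addHaar_eq_smul_addHaar (volume : Measure (Euc d)) hB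
  rw [← integral_map B.continuous_of_finiteDimensional.aemeasurable hg.aestronglyMeasurable, hmap,
    integral_smul_measure, ENNReal.toReal_ofReal (abs_nonneg _), abs_inv, smul_eq_mul]

end Gaussian

section Hessian

variable {d : ℕ} {U : Euc d → ℝ} {m : Euc d}

lemma ContDiff.hasFDerivAt_gradient (hU : ContDiff ℝ 2 U) (x : Euc d) :
    HasFDerivAt (gradient U) (fderiv ℝ (gradient U) x) x := by
  have h1 : ContDiff ℝ 1 (fderiv ℝ U) := hU.fderiv_right (by norm_num)
  have h2 : Differentiable ℝ (fderiv ℝ U) := h1.differentiable (by norm_num)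
  have h3 : Differentiable ℝ (gradient U) :=
    (InnerProductSpace.toDual ℝ (Euc d)).symm.toContinuousLinearEquiv.differentiable.comp h2
  exact (h3 x).hasFDerivAt

lemma inner_fderiv_gradient (hU : ContDiff ℝ 2 U) (x y z : Euc d) :
    ⟪fderiv ℝ (gradient U) x y, z⟫_ℝ = fderiv ℝ (fderiv ℝ U) x y z := by
  have h1 : HasFDerivAt (fun w => InnerProductSpace.toDual ℝ (Euc d) (gradient U w))
      ((InnerProductSpace.toDual ℝ (Euc d)).toContinuousLinearEquiv.toContinuousLinearMap ∘L
        fderiv ℝ (gradient U) x) x :=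
    (InnerProductSpace.toDual ℝ (Euc d)).toContinuousLinearEquiv.toContinuousLinearMap.hasFDerivAt.comp
      x (hU.hasFDerivAt_gradient x)
  have h2 : (fun w => InnerProductSpace.toDual ℝ (Euc d) (gradient U w)) = fderiv ℝ U := by
    funext w; exact toDual_gradient
  rw [h2] at h1
  rw [h1.fderiv]
  simp

lemma inner_fderiv_gradient_comm (hU : ContDiff ℝ 2 U) (x y z : Euc d) :
    ⟪fderiv ℝ (gradient U) x y, z⟫_ℝ = ⟪y, fderiv ℝ (gradient U) x z⟫_ℝ := by
  rw [real_inner_comm _ y, inner_fderiv_gradient hU, inner_fderiv_gradient hU]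
  exact (hU.contDiffAt.isSymmSndFDerivAt (by simp)).eq _ _

/-- Second-order Taylor expansion at a critical point. -/
lemma ContDiff.taylor_two_isLittleO (hU : ContDiff ℝ 2 U) (hm : gradient U m = 0) :
    (fun z : Euc d => U (m + z) - U m - 1 / 2 * ⟪fderiv ℝ (gradient U) m z, z⟫_ℝ)
      =o[𝓝 0] fun z => ‖z‖ ^ 2 := by
  set H := fderiv ℝ (gradient U) m with hH
  have hg : ∀ z, HasFDerivAt
      (fun z : Euc d => U (m + z) - U m - 1 / 2 * ⟪H z, z⟫_ℝ)
      (InnerProductSpace.toDual ℝ (Euc d) (gradient U (m + z) - H z)) z := by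
    intro z
    have hUd : HasFDerivAt U (fderiv ℝ U (m + z)) (m + z) :=
      (hU.differentiable (by norm_num) _).hasFDerivAt
    have hsh : HasFDerivAt (fun z : Euc d => m + z) (ContinuousLinearMap.id ℝ _) z :=
      (hasFDerivAt_id z).const_add m
    have h1 := hUd.comp z hsh
    have h2 := (H.hasFDerivAt (x := z)).inner ℝ (hasFDerivAt_id z)
    refine ((h1.sub_const (U m)).sub (h2.const_mul (1 / 2))).congr_fderiv ?_
    ext w
    have hsymm : ⟪H w, z⟫_ℝ = ⟪H z, w⟫_ℝ := by
      rw [inner_fderiv_gradient_comm hU, real_inner_comm]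
    have hgr : fderiv ℝ U (m + z) w = ⟪gradient U (m + z), w⟫_ℝ := by
      rw [← toDual_gradient]; simp
    simp only [ContinuousLinearMap.comp_id, _root_.sub_apply,
      _root_.smul_apply, hgr, InnerProductSpace.toDual_apply_apply, inner_sub_left,
      ContinuousLinearMap.comp_apply, ContinuousLinearMap.prod_apply, fderivInnerCLM_apply,
      ContinuousLinearMap.id_apply, hsymm, smul_eq_mul, id]
    ring
  rw [Asymptotics.isLittleO_iff]
  intro c hc
  have hlo := (hU.hasFDerivAt_gradient m).isLittleO
  rw [Asymptotics.isLittleO_iff] at hlo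
  have hlo := hlo hc
  obtain ⟨δ, hδ, hball⟩ := Metric.eventually_nhds_iff.1 hlo
  refine Metric.eventually_nhds_iff.2 ⟨δ, hδ, fun z hz => ?_⟩
  have hz' : ‖z‖ < δ := by simpa using hz
  have := (convex_closedBall (0 : Euc d) ‖z‖).norm_image_sub_le_of_norm_hasFDerivWithin_le
    (C := c * ‖z‖) (fun w _ => (hg w).hasFDerivWithinAt) (fun w hw => ?_)
    (show (0 : Euc d) ∈ _ by simp) (show z ∈ _ by simp)
  · simpa [sq, mul_assoc, abs_mul] using this
  · have hw' : ‖w‖ ≤ ‖z‖ := by simpa using hw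
    have := hball (y := m + w) (by simpa using hw'.trans_lt hz')
    rw [hm] at this
    simp only [add_sub_cancel_left, sub_zero] at this
    rw [LinearIsometryEquiv.norm_map]
    exact this.trans (by gcongr)

end Hessian

section LocalMinimum

variable {d : ℕ} {U : Euc d → ℝ} {m : Euc d}

lemma ContDiff.tendsto_second_difference (hU : ContDiff ℝ 2 U) (hm : gradient U m = 0)
    (z : Euc d) :
    Tendsto (fun t : ℝ => (U (m + t • z) - U m) / t ^ 2) (𝓝[>] 0)
      (𝓝 (1 / 2 * ⟪fderiv ℝ (gradient U) m z, z⟫_ℝ)) := by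
  have ht : Tendsto (fun t : ℝ => t • z) (𝓝[>] 0) (𝓝 0) := by
    have : Continuous fun t : ℝ => t • z := by fun_prop
    simpa using (this.tendsto 0).mono_left nhdsWithin_le_nhds
  have h1 := (hU.taylor_two_isLittleO hm).comp_tendsto ht
  have h2 : (fun t : ℝ => U (m + t • z) - U m
      - 1 / 2 * ⟪fderiv ℝ (gradient U) m (t • z), t • z⟫_ℝ) =o[𝓝[>] 0] fun t : ℝ => t ^ 2 := by
    refine h1.trans_isBigO (Asymptotics.IsBigO.of_bound (‖z‖ ^ 2) (.of_forall fun t => ?_))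
    simp [norm_smul, mul_pow, mul_comm]
  have h3 := h2.tendsto_div_nhds_zero.add_const (1 / 2 * ⟪fderiv ℝ (gradient U) m z, z⟫_ℝ)
  rw [zero_add] at h3
  refine h3.congr' ?_
  filter_upwards [self_mem_nhdsWithin] with t ht
  have : t ≠ 0 := (show (0 : ℝ) < t from ht).ne'
  simp only [map_smul, inner_smul_left, inner_smul_right, RCLike.conj_to_real]
  field_simp
  ring

lemma gradient_eq_zero_of_forall_le (hmin : ∀ x, U m ≤ U x) : gradient U m = 0 := by
  have : IsLocalMin U m := .of_forall hmin
  simp [gradient, this.fderiv_eq_zero]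

lemma isPositive_hessian (hU : ContDiff ℝ 2 U) (hmin : ∀ x, U m ≤ U x) :
    (fderiv ℝ (gradient U) m).toLinearMap.IsPositive := by
  refine ⟨fun y z => inner_fderiv_gradient_comm hU m y z, fun z => ?_⟩
  have := ge_of_tendsto' (hU.tendsto_second_difference (gradient_eq_zero_of_forall_le hmin) z)
    (b := 0) fun t => div_nonneg (sub_nonneg.2 (hmin _)) (sq_nonneg t)
  simpa using this

/-- At a nondegenerate global minimum that is strict on a ball, the potential grows at least
quadratically on that ball. -/
lemma exists_quadratic_lower_bound (hU : ContDiff ℝ 2 U) (hmin : ∀ x, U m ≤ U x)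
    {B : Euc d →ₗ[ℝ] Euc d} (hB : LinearMap.det B ≠ 0)
    (hHB : ∀ y, ⟪fderiv ℝ (gradient U) m y, y⟫_ℝ = ‖B y‖ ^ 2) {r : ℝ} (hr : 0 < r)
    (hstrict : ∀ x ∈ Metric.closedBall m r, U x = U m → x = m) :
    ∃ c > 0, ∀ z : Euc d, ‖z‖ ≤ r → c * ‖z‖ ^ 2 ≤ U (m + z) - U m := by
  have hker : LinearMap.ker B = ⊥ :=
    LinearMap.ker_eq_bot.2 (LinearMap.equivOfDetNeZero B hB).injective
  obtain ⟨K, hK, hanti⟩ := LinearMap.exists_antilipschitzWith B hker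
  have hlow : ∀ z, ‖z‖ ^ 2 ≤ (K : ℝ) ^ 2 * ‖B z‖ ^ 2 := fun z => by
    have := ZeroHomClass.bound_of_antilipschitz B hanti z
    rw [← mul_pow]; gcongr
  have hK' : (0 : ℝ) < K := hK
  set k : ℝ := 1 / (4 * (K : ℝ) ^ 2) with hk
  have hkpos : 0 < k := by positivity
  have hlo := (hU.taylor_two_isLittleO (gradient_eq_zero_of_forall_le hmin))
  rw [Asymptotics.isLittleO_iff] at hlo
  obtain ⟨δ, hδ, hball⟩ := Metric.eventually_nhds_iff.1 (hlo hkpos)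
  have hnear : ∀ z : Euc d, ‖z‖ < δ → k * ‖z‖ ^ 2 ≤ U (m + z) - U m := by
    intro z hz
    have h1 := hball (y := z) (by simpa using hz)
    rw [hHB, Real.norm_eq_abs, Real.norm_of_nonneg (sq_nonneg _)] at h1
    have h2 : 4 * k * ‖z‖ ^ 2 ≤ ‖B z‖ ^ 2 := by
      have h4 : 4 * k = ((K : ℝ) ^ 2)⁻¹ := by rw [hk]; field_simp
      rw [h4, inv_mul_le_iff₀ (by positivity)]
      exact hlow z
    have := (abs_le.1 h1).1
    linarith
  have hcont : Continuous fun z => U (m + z) - U m :=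
    (hU.continuous.comp (continuous_const.add continuous_id)).sub continuous_const
  have hcomp : IsCompact (Metric.closedBall (0 : Euc d) r \ Metric.ball 0 δ) :=
    (isCompact_closedBall _ _).diff Metric.isOpen_ball
  obtain ⟨v, hv, hfar⟩ : ∃ v > 0, ∀ z ∈ Metric.closedBall (0 : Euc d) r \ Metric.ball 0 δ,
      v ≤ U (m + z) - U m := by
    refine hcomp.exists_forall_le' hcont.continuousOn fun z hz => ?_
    refine sub_pos.2 (lt_of_le_of_ne (hmin _) fun heq => ?_)
    have := hstrict (m + z) (by simpa using hz.1) heq.symm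
    have hz0 : z = 0 := by simpa using this
    exact hz.2 (by simpa [hz0] using hδ)
  refine ⟨min k (v / r ^ 2), lt_min hkpos (by positivity), fun z hz => ?_⟩
  rcases lt_or_ge ‖z‖ δ with h | h
  · exact (mul_le_mul_of_nonneg_right (min_le_left _ _) (sq_nonneg _)).trans (hnear z h)
  · calc min k (v / r ^ 2) * ‖z‖ ^ 2 ≤ v / r ^ 2 * r ^ 2 := by
          gcongr
          exact min_le_right _ _
      _ = v := by field_simp
      _ ≤ _ := hfar z ⟨by simpa using hz, by simpa using h⟩

/-- Laplace's method on a ball around a nondegenerate global minimum. -/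
lemma tendsto_laplace_closedBall (hU : ContDiff ℝ 2 U) (hmin : ∀ x, U m ≤ U x)
    (hinj : Function.Injective (fderiv ℝ (gradient U) m)) {r : ℝ} (hr : 0 < r)
    (hstrict : ∀ x ∈ Metric.closedBall m r, U x = U m → x = m) :
    0 < 1 / √(detHess U m) ∧
    Tendsto (fun ε : ℝ => (√ε ^ d)⁻¹ *
        ∫ x in Metric.closedBall m r, Real.exp (-(U x - U m) / ε)) (𝓝[>] 0)
      (𝓝 ((1 / √(detHess U m)) * ∫ x : Euc d, Real.exp (-(1 / 2) * ‖x‖ ^ 2))) := by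
  obtain ⟨B, hHB, hdet⟩ := exists_inner_eq_norm_sq_and_det_eq_sq (isPositive_hessian hU hmin)
  have hB : LinearMap.det B ≠ 0 := by
    have : IsUnit (LinearMap.det (fderiv ℝ (gradient U) m).toLinearMap) :=
      (LinearEquiv.ofInjectiveEndo _ hinj).isUnit_det'
    rw [hdet] at this
    exact fun h0 => this.ne_zero (by simp [h0])
  have hsqrt : 1 / √(detHess U m) = |LinearMap.det B|⁻¹ := by
    rw [detHess, hdet, Real.sqrt_sq_eq_abs, one_div]
  refine ⟨by rw [hsqrt]; positivity, ?_⟩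
  obtain ⟨c, hc, hlow⟩ := exists_quadratic_lower_bound hU hmin hB hHB hr hstrict
  rw [hsqrt, ← integral_comp_linearMap hB (g := fun x => Real.exp (-(1 / 2) * ‖x‖ ^ 2))
    (by fun_prop)]
  set F : ℝ → Euc d → ℝ := fun ε =>
    (Metric.closedBall m r).indicator fun x => Real.exp (-(U x - U m) / ε)
  have hFm : ∀ ε, Measurable (F ε) := fun ε => by
    refine Measurable.indicator (Continuous.measurable ?_) measurableSet_closedBall
    have := hU.continuous
    fun_prop
  have hrescale : ∀ᶠ ε : ℝ in 𝓝[>] 0, ∫ y, F ε (m + √ε • y) = (√ε ^ d)⁻¹ *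
      ∫ x in Metric.closedBall m r, Real.exp (-(U x - U m) / ε) := by
    filter_upwards [self_mem_nhdsWithin] with ε hε
    rw [Measure.integral_comp_smul_of_nonneg volume (fun z => F ε (m + z)) (√ε)
      (hR := Real.sqrt_nonneg ε), integral_add_left_eq_self (F ε) m,
      integral_indicator measurableSet_closedBall]
    simp
  refine Tendsto.congr' hrescale ?_
  refine tendsto_integral_filter_of_dominated_convergence
    (fun y => Real.exp (-c * ‖y‖ ^ 2)) (.of_forall fun ε => ?_) ?_
    (integrable_exp_neg_mul_norm_sq hc) (.of_forall fun y => ?_)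
  · exact ((hFm ε).comp (by fun_prop)).aestronglyMeasurable
  · filter_upwards [self_mem_nhdsWithin] with ε hε
    have hε : 0 < ε := hε
    refine .of_forall fun y => ?_
    by_cases hy : m + √ε • y ∈ Metric.closedBall m r
    · simp only [F, indicator_of_mem hy, Real.norm_eq_abs, Real.abs_exp]
      have := hlow (√ε • y) (by simpa using hy)
      rw [norm_smul, mul_pow, Real.norm_of_nonneg (Real.sqrt_nonneg _), Real.sq_sqrt hε.le] at this
      rw [Real.exp_le_exp, div_le_iff₀ hε]
      linarith
    · simp only [F, indicator_of_notMem hy, norm_zero]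
      positivity
  · have hsq : Tendsto (fun ε : ℝ => √ε) (𝓝[>] 0) (𝓝[>] 0) := by
      refine tendsto_nhdsWithin_iff.2 ⟨?_, ?_⟩
      · simpa using (Real.continuous_sqrt.tendsto 0).mono_left nhdsWithin_le_nhds
      · filter_upwards [self_mem_nhdsWithin] with ε hε using Real.sqrt_pos.2 hε
    have hlim := (hU.tendsto_second_difference (gradient_eq_zero_of_forall_le hmin) y).comp hsq
    have hexp := (Real.continuous_exp.tendsto _).comp hlim.neg
    rw [show fderiv ℝ (gradient U) m y = (fderiv ℝ (gradient U) m).toLinearMap y from rfl,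
      hHB, ← neg_mul] at hexp
    refine hexp.congr' ?_
    have hin : ∀ᶠ ε : ℝ in 𝓝[>] 0, m + √ε • y ∈ Metric.closedBall m r := by
      have hcont : Continuous fun ε : ℝ => m + √ε • y := by fun_prop
      have : Tendsto (fun ε : ℝ => m + √ε • y) (𝓝[>] 0) (𝓝 m) := by
        simpa using (hcont.tendsto 0).mono_left nhdsWithin_le_nhds
      exact this (Metric.closedBall_mem_nhds m hr)
    filter_upwards [hin, self_mem_nhdsWithin] with ε hy hε
    have hε : 0 < ε := hε
    simp only [F, indicator_of_mem hy, Function.comp_apply, Real.sq_sqrt hε.le]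
    congr 1
    ring

end LocalMinimum

section Tail

variable {d : ℕ} {U : Euc d → ℝ} {h : ℝ}

lemma integrable_exp_neg_norm : Integrable fun x : Euc d => Real.exp (-‖x‖) := by
  have hint := (integrable_one_add_norm (E := Euc d) (μ := volume) (r := ((d + 1 : ℕ) : ℝ))
    (by simp)).const_mul (Real.exp 1 * (d + 1).factorial)
  refine hint.mono' (by fun_prop) (.of_forall fun x => ?_)
  have h1 := Real.pow_div_factorial_le_exp (1 + ‖x‖) (by positivity) (d + 1)
  rw [Real.exp_add] at h1
  rw [Real.norm_eq_abs, Real.abs_exp, Real.exp_neg, Real.rpow_neg (by positivity),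
    Real.rpow_natCast, ← div_eq_mul_inv, inv_eq_one_div, div_le_div_iff₀ (by positivity)
    (by positivity), one_mul]
  rw [div_le_iff₀ (by positivity)] at h1
  linarith

lemma GrowthConditions.exists_norm_sub_le (hG : GrowthConditions U) (hmin : ∀ x, h ≤ U x) :
    ∃ C : ℝ, ∀ x, ‖x‖ - C ≤ U x - h := by
  obtain ⟨R, hR⟩ := hG.1 1
  refine ⟨max R 1 + |h|, fun x => ?_⟩
  rcases le_total (max R 1) ‖x‖ with hx | hx
  · have hx1 : 1 ≤ ‖x‖ := (le_max_right _ _).trans hx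
    have := hR x ((le_max_left _ _).trans hx)
    rw [le_div_iff₀ (by linarith)] at this
    linarith [le_abs_self h, le_max_right R 1]
  · linarith [hmin x, abs_nonneg h]

lemma GrowthConditions.integrable_exp_neg (hG : GrowthConditions U) (hU : Continuous U)
    (hmin : ∀ x, h ≤ U x) : Integrable fun x => Real.exp (-(U x - h)) := by
  obtain ⟨C, hC⟩ := hG.exists_norm_sub_le hmin
  refine (integrable_exp_neg_norm.const_mul (Real.exp C)).mono' (by fun_prop)
    (.of_forall fun x => ?_)
  rw [Real.norm_eq_abs, Real.abs_exp, ← Real.exp_add, Real.exp_le_exp]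
  linarith [hC x]

lemma GrowthConditions.integrable_exp_neg_div (hG : GrowthConditions U) (hU : Continuous U)
    (hmin : ∀ x, h ≤ U x) {ε : ℝ} (hε : 0 < ε) (hε1 : ε ≤ 1) :
    Integrable fun x => Real.exp (-(U x - h) / ε) := by
  refine (hG.integrable_exp_neg hU hmin).mono' (by fun_prop) (.of_forall fun x => ?_)
  rw [Real.norm_eq_abs, Real.abs_exp, Real.exp_le_exp, div_le_iff₀ hε]
  nlinarith [hmin x]

lemma GrowthConditions.exists_pos_le_of_notMem (hG : GrowthConditions U) (hU : Continuous U)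
    (hmin : ∀ x, h ≤ U x) {O : Set (Euc d)} (hO : IsOpen O) (hsub : {x | U x = h} ⊆ O) :
    ∃ δ > 0, ∀ x ∉ O, δ ≤ U x - h := by
  obtain ⟨C, hC⟩ := hG.exists_norm_sub_le hmin
  obtain ⟨v, hv, hle⟩ : ∃ v > 0, ∀ x ∈ Metric.closedBall (0 : Euc d) (C + 1) \ O,
      v ≤ U x - h := by
    refine ((isCompact_closedBall _ _).diff hO).exists_forall_le'
      (hU.sub continuous_const).continuousOn fun x hx => ?_
    exact sub_pos.2 (lt_of_le_of_ne (hmin x) fun heq => hx.2 (hsub heq.symm))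
  refine ⟨min v 1, lt_min hv one_pos, fun x hx => ?_⟩
  rcases le_total ‖x‖ (C + 1) with h1 | h1
  · exact (min_le_left _ _).trans (hle x ⟨by simpa using h1, hx⟩)
  · exact (min_le_right _ _).trans (by linarith [hC x])

lemma tendsto_sqrt_pow_inv_mul_exp (d : ℕ) {δ : ℝ} (hδ : 0 < δ) :
    Tendsto (fun ε : ℝ => (√ε ^ d)⁻¹ * Real.exp (-δ * ε⁻¹)) (𝓝[>] 0) (𝓝 0) := by
  have := (tendsto_rpow_mul_exp_neg_mul_atTop_nhds_zero ((d : ℝ) / 2) δ hδ).comp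
    tendsto_inv_nhdsGT_zero
  refine this.congr' ?_
  filter_upwards [self_mem_nhdsWithin] with ε hε
  have hε : 0 < ε := hε
  simp only [Function.comp_apply]
  rw [Real.inv_rpow hε.le, Real.sqrt_eq_rpow, ← Real.rpow_natCast, ← Real.rpow_mul hε.le]
  ring_nf

/-- The part of the Gibbs weight away from the minimizers is negligible. -/
lemma GrowthConditions.tendsto_laplace_compl (hG : GrowthConditions U) (hU : Continuous U)
    (hmin : ∀ x, h ≤ U x) {O S : Set (Euc d)} (hO : IsOpen O) (hsub : {x | U x = h} ⊆ O)
    (hS : MeasurableSet S) (hSO : Disjoint S O) :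
    Tendsto (fun ε : ℝ => (√ε ^ d)⁻¹ * ∫ x in S, Real.exp (-(U x - h) / ε)) (𝓝[>] 0) (𝓝 0) := by
  obtain ⟨δ, hδ, hle⟩ := hG.exists_pos_le_of_notMem hU hmin hO hsub
  have hint := hG.integrable_exp_neg hU hmin
  have hlim := (tendsto_sqrt_pow_inv_mul_exp d hδ).mul_const
    (Real.exp δ * ∫ x, Real.exp (-(U x - h)))
  rw [zero_mul] at hlim
  refine squeeze_zero' (.of_forall fun ε => by positivity) ?_ hlim
  filter_upwards [Ioo_mem_nhdsGT (zero_lt_one (α := ℝ))] with ε ⟨hε, hε1⟩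
  rw [mul_assoc, ← mul_assoc (Real.exp _), ← Real.exp_add]
  gcongr
  calc ∫ x in S, Real.exp (-(U x - h) / ε)
      ≤ ∫ x in S, Real.exp (-δ * ε⁻¹ + δ) * Real.exp (-(U x - h)) := by
        refine setIntegral_mono_on (hG.integrable_exp_neg_div hU hmin hε hε1.le).integrableOn
          (hint.const_mul _).integrableOn hS fun x hx => ?_
        rw [← Real.exp_add, Real.exp_le_exp, div_eq_mul_inv]
        have h1 := hle x (hSO.notMem_of_mem_left hx)
        have h2 : 1 ≤ ε⁻¹ := (one_le_inv₀ hε).2 hε1.le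
        nlinarith
    _ = Real.exp (-δ * ε⁻¹ + δ) * ∫ x in S, Real.exp (-(U x - h)) := integral_const_mul _ _
    _ ≤ _ := mul_le_mul_of_nonneg_left
        (setIntegral_le_integral hint (.of_forall fun x => (Real.exp_pos _).le)) (Real.exp_pos _).le

end Tail

lemma gibbs_toReal {d : ℕ} {U : Euc d → ℝ} (hU : Continuous U) (h : ℝ) {ε : ℝ} (hε : 0 < ε)
    {S : Set (Euc d)} (hS : MeasurableSet S) :
    (gibbs U ε S).toReal =
      ((√ε ^ d)⁻¹ * ∫ x in S, Real.exp (-(U x - h) / ε)) /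
        ((√ε ^ d)⁻¹ * ∫ x, Real.exp (-(U x - h) / ε)) := by
  have hshift : ∀ x, Real.exp (-U x / ε) = Real.exp (-h / ε) * Real.exp (-(U x - h) / ε) :=
    fun x => by rw [← Real.exp_add]; ring_nf
  have hint : (∫⁻ x in S, ENNReal.ofReal (Real.exp (-U x / ε))).toReal =
      ∫ x in S, Real.exp (-U x / ε) :=
    (integral_eq_lintegral_of_nonneg_ae (.of_forall fun x => (Real.exp_pos _).le)
      (Continuous.aestronglyMeasurable (by fun_prop))).symm
  have hZ : 0 ≤ ∫ x, Real.exp (-U x / ε) := integral_nonneg fun x => (Real.exp_pos _).le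
  have hsqrt : (√ε ^ d)⁻¹ ≠ 0 := inv_ne_zero (pow_ne_zero _ (Real.sqrt_pos.2 hε).ne')
  rw [gibbs, Measure.smul_apply, withDensity_apply _ hS, smul_eq_mul, ENNReal.toReal_mul,
    ENNReal.toReal_inv, ENNReal.toReal_ofReal hZ, hint, mul_div_mul_left _ _ hsqrt]
  simp only [hshift, integral_const_mul]
  rw [← div_eq_inv_mul, mul_div_mul_left _ _ (Real.exp_pos _).ne']

/-- Proposition 3.2 of the paper: concentration of the Gibbs measure on the
union of small balls around the global minima, with the precise limiting proportions. -/
theorem gibbs_concentration {d : ℕ} (U : Euc d → ℝ)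
    (hU : ContDiff ℝ 2 U) (hMorse : IsMorse U) (hGrowth : GrowthConditions U)
    (h : ℝ) (hmin : IsLeast (Set.range U) h)
    (hfin : {x : Euc d | U x = h}.Finite) (hne : {x : Euc d | U x = h}.Nonempty)
    (r₀ : ℝ) (hr₀ : 0 < r₀)
    (hdisj : {x : Euc d | U x = h}.Pairwise fun m m' =>
        Disjoint (Metric.closedBall m r₀) (Metric.closedBall m' r₀)) :
    (∀ A ⊆ {x : Euc d | U x = h},
      Tendsto (fun ε : ℝ => ((gibbs U ε) (⋃ m ∈ A, Metric.closedBall m r₀)).toReal)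
        (𝓝[>] 0)
        (𝓝 ((∑ᶠ m ∈ A, 1 / Real.sqrt (detHess U m)) /
              (∑ᶠ m ∈ {x : Euc d | U x = h}, 1 / Real.sqrt (detHess U m)))))
    ∧ Tendsto
        (fun ε : ℝ =>
          ((gibbs U ε) ((⋃ m ∈ {x : Euc d | U x = h}, Metric.closedBall m r₀)ᶜ)).toReal)
        (𝓝[>] 0) (𝓝 0) := by
  have hminU : ∀ x, h ≤ U x := fun x => hmin.2 ⟨x, rfl⟩
  have hUc := hU.continuous
  set M : Set (Euc d) := {x | U x = h} with hM
  set G : ℝ := ∫ x : Euc d, Real.exp (-(1 / 2) * ‖x‖ ^ 2) with hG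
  have hGpos : 0 < G := integral_exp_neg_half_norm_sq_pos
  set N : ℝ → Set (Euc d) → ℝ := fun ε S =>
    (√ε ^ d)⁻¹ * ∫ x in S, Real.exp (-(U x - h) / ε) with hN
  have hball : ∀ m ∈ M, 0 < 1 / √(detHess U m) ∧
      Tendsto (fun ε => N ε (Metric.closedBall m r₀)) (𝓝[>] 0)
        (𝓝 (1 / √(detHess U m) * G)) := by
    intro m hm
    have hm' : U m = h := hm
    have hle : ∀ x, U m ≤ U x := fun x => hm' ▸ hminU x
    have := tendsto_laplace_closedBall hU hle
      (hMorse m (gradient_eq_zero_of_forall_le hle)).1 hr₀ fun x hx hxm => by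
        by_contra hne
        exact (hdisj (hxm.trans hm') hm hne).notMem_of_mem_left
          (Metric.mem_closedBall_self hr₀.le) hx
    simpa only [hm'] using this
  have hmeas : ∀ A ⊆ M, MeasurableSet (⋃ m ∈ A, Metric.closedBall m r₀) := fun A hA =>
    (hfin.subset hA).measurableSet_biUnion fun m _ => measurableSet_closedBall
  have hunion : ∀ A ⊆ M, Tendsto (fun ε => N ε (⋃ m ∈ A, Metric.closedBall m r₀)) (𝓝[>] 0)
      (𝓝 ((∑ᶠ m ∈ A, 1 / √(detHess U m)) * G)) := by
    intro A hA
    lift A to Finset (Euc d) using hfin.subset hA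
    rw [finsum_mem_coe_finset, Finset.sum_mul]
    refine (tendsto_finsetSum _ fun m hm => (hball m (hA hm)).2).congr' ?_
    filter_upwards [Ioo_mem_nhdsGT (zero_lt_one (α := ℝ))] with ε ⟨hε, hε1⟩
    have hint := hGrowth.integrable_exp_neg_div hUc hminU hε hε1.le
    simp only [hN, Finset.mem_coe]
    rw [integral_biUnion_finset A (fun _ _ => measurableSet_closedBall) (hdisj.mono hA)
      (fun _ _ => hint.integrableOn), Finset.mul_sum]
  have hcompl : Tendsto (fun ε => N ε (⋃ m ∈ M, Metric.closedBall m r₀)ᶜ) (𝓝[>] 0) (𝓝 0) := by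
    refine hGrowth.tendsto_laplace_compl hUc hminU (O := ⋃ m ∈ M, Metric.ball m r₀)
      (isOpen_biUnion fun _ _ => Metric.isOpen_ball)
      (fun x hx => mem_biUnion hx (Metric.mem_ball_self hr₀)) (hmeas M subset_rfl).compl ?_
    exact disjoint_compl_left.mono_right
      (biUnion_mono subset_rfl fun _ _ => Metric.ball_subset_closedBall)
  have htotal : Tendsto (fun ε => (√ε ^ d)⁻¹ * ∫ x, Real.exp (-(U x - h) / ε)) (𝓝[>] 0)
      (𝓝 ((∑ᶠ m ∈ M, 1 / √(detHess U m)) * G)) := by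
    have := (hunion M subset_rfl).add hcompl
    rw [add_zero] at this
    refine this.congr' ?_
    filter_upwards [Ioo_mem_nhdsGT (zero_lt_one (α := ℝ))] with ε ⟨hε, hε1⟩
    have hint := hGrowth.integrable_exp_neg_div hUc hminU hε hε1.le
    simp only [hN]
    rw [← mul_add, integral_add_compl (hmeas M subset_rfl) hint]
  have hν : 0 < ∑ᶠ m ∈ M, 1 / √(detHess U m) := by
    rw [finsum_mem_eq_finite_toFinset_sum _ hfin]
    exact Finset.sum_pos (fun m hm => (hball m (hfin.mem_toFinset.1 hm)).1)
      (hfin.toFinset_nonempty.2 hne)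
  have hratio : ∀ {S : Set (Euc d)} {a : ℝ}, MeasurableSet S →
      Tendsto (fun ε => N ε S) (𝓝[>] 0) (𝓝 (a * G)) →
      Tendsto (fun ε => (gibbs U ε S).toReal) (𝓝[>] 0)
        (𝓝 (a / ∑ᶠ m ∈ M, 1 / √(detHess U m))) := by
    intro S a hS ha
    have := ha.div htotal (mul_pos hν hGpos).ne'
    rw [mul_div_mul_right _ _ hGpos.ne'] at this
    refine this.congr' ?_
    filter_upwards [self_mem_nhdsWithin] with ε hε
    exact (gibbs_toReal hUc h hε hS).symm
  refine ⟨fun A hA => hratio (hmeas A hA) (hunion A hA), ?_⟩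
  simpa using hratio (a := 0) (hmeas M subset_rfl).compl (by simpa using hcompl)
end
end

section
/- Let S be a finite set, ω : S × S → [0,∞) symmetric with ω(i,i) = 0, connected in the sense that for every nonempty proper subset A ⊂ S there exist i ∈ A and j ∉ A with ω(i,j) > 0. Let S⋆ ⊆ S with |S⋆| ≥ 2. For disjoint nonempty A, B ⊆ S let h_{A,B} : S → ℝ be the (unique) function equal to 1 on A, 0 on B, and harmonic at every i ∉ A∪B, and set cap(A,B) = D(h_{A,B}, h_{A,B}), with the convention cap(A,∅) = 0. For distinct i, j ∈ S⋆ set β_{i,j} = (1/2)[cap({i}, S⋆∖{i}) + cap({j}, S⋆∖{j}) − cap({i,j}, S⋆∖{i,j})]. Then for any u, v : S⋆ → ℝ and any harmonic extensions ũ, ṽ : S → ℝ (extensions of u, v that are harmonic at every i ∈ S ∖ S⋆), one has D(ũ, ṽ) = (1/2) Σ_{i,j∈S⋆} β_{i,j} (u(i)−u(j)) (v(i)−v(j)). -/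
open scoped BigOperators

/-- The Dirichlet form of the weights `ω`, as a bilinear form. -/
noncomputable def dirichletForm {S : Type*} [Fintype S] (ω : S → S → ℝ) :
    (S → ℝ) →ₗ[ℝ] (S → ℝ) →ₗ[ℝ] ℝ :=
  LinearMap.mk₂ ℝ (fun f g => (1 / 2) * ∑ i, ∑ j, ω i j * (f i - f j) * (g i - g j))
    (fun f f' g => by
      rw [← mul_add, ← Finset.sum_add_distrib]
      simp_rw [← Finset.sum_add_distrib, Pi.add_apply]
      congr 1
      refine Finset.sum_congr rfl fun i _ => Finset.sum_congr rfl fun j _ => ?_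
      ring)
    (fun c f g => by
      rw [smul_eq_mul, mul_left_comm]
      simp_rw [Finset.mul_sum, Pi.smul_apply, smul_eq_mul]
      refine Finset.sum_congr rfl fun i _ => Finset.sum_congr rfl fun j _ => ?_
      ring)
    (fun f g g' => by
      rw [← mul_add, ← Finset.sum_add_distrib]
      simp_rw [← Finset.sum_add_distrib, Pi.add_apply]
      congr 1
      refine Finset.sum_congr rfl fun i _ => Finset.sum_congr rfl fun j _ => ?_
      ring)
    (fun c f g => by
      rw [smul_eq_mul, mul_left_comm]
      simp_rw [Finset.mul_sum, Pi.smul_apply, smul_eq_mul]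
      refine Finset.sum_congr rfl fun i _ => Finset.sum_congr rfl fun j _ => ?_
      ring)

section

variable {S : Type*} [Fintype S] {ω : S → S → ℝ}

theorem dirichletForm_apply (f g : S → ℝ) :
    dirichletForm ω f g = (1 / 2) * ∑ i, ∑ j, ω i j * (f i - f j) * (g i - g j) := rfl

theorem dirichletForm_comm (f g : S → ℝ) : dirichletForm ω f g = dirichletForm ω g f := by
  simp only [dirichletForm_apply, mul_right_comm]

theorem dirichletForm_one_right (f : S → ℝ) : dirichletForm ω f 1 = 0 := by
  simp [dirichletForm_apply]

/-- Summation by parts: the Dirichlet form is minus the pairing with the Laplacian. -/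
theorem dirichletForm_eq_neg_sum (hsym : ∀ i j, ω i j = ω j i) (f g : S → ℝ) :
    dirichletForm ω f g = -∑ i, f i * ∑ j, ω i j * (g j - g i) := by
  have key : ∑ i, ∑ j, f j * (ω i j * (g i - g j)) = ∑ i, ∑ j, f i * (ω i j * (g j - g i)) := by
    rw [Finset.sum_comm]
    simp only [hsym]
  have expand : ∑ i, ∑ j, ω i j * (f i - f j) * (g i - g j)
      = -(∑ i, ∑ j, f i * (ω i j * (g j - g i))) - ∑ i, ∑ j, f j * (ω i j * (g i - g j)) := by
    simp only [← Finset.sum_neg_distrib, ← Finset.sum_sub_distrib]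
    refine Finset.sum_congr rfl fun i _ => Finset.sum_congr rfl fun j _ => ?_
    ring
  simp only [dirichletForm_apply, expand, key, Finset.mul_sum]
  ring

/-- The Dirichlet problem with zero boundary data has only the zero solution. -/
theorem eq_zero_of_harmonic (hnn : ∀ i j, 0 ≤ ω i j) (hsym : ∀ i j, ω i j = ω j i)
    (hconn : ∀ A : Set S, A.Nonempty → A ≠ Set.univ → ∃ i ∈ A, ∃ j ∉ A, 0 < ω i j)
    {B : Set S} (hB : B.Nonempty) {f : S → ℝ} (hf0 : ∀ i ∈ B, f i = 0)
    (hf : ∀ i ∉ B, ∑ j, ω i j * (f j - f i) = 0) : f = 0 := by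
  have hD : dirichletForm ω f f = 0 := by
    rw [dirichletForm_eq_neg_sum hsym, neg_eq_zero]
    refine Finset.sum_eq_zero fun i _ => ?_
    by_cases hi : i ∈ B
    · rw [hf0 i hi, zero_mul]
    · rw [hf i hi, mul_zero]
  have hterm : ∀ i j, 0 ≤ ω i j * (f i - f j) * (f i - f j) := fun i j => by
    rw [mul_assoc]
    exact mul_nonneg (hnn i j) (mul_self_nonneg _)
  have hzero : ∀ i j, ω i j * (f i - f j) * (f i - f j) = 0 := by
    rw [dirichletForm_apply, mul_eq_zero_iff_left (by norm_num),
      Finset.sum_eq_zero_iff_of_nonneg fun i _ => Finset.sum_nonneg fun j _ => hterm i j] at hD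
    intro i j
    exact (Finset.sum_eq_zero_iff_of_nonneg fun j _ => hterm i j).1
      (hD i (Finset.mem_univ i)) j (Finset.mem_univ j)
  by_contra hne
  obtain ⟨i, hi, j, hj, hij⟩ := hconn {i | f i = 0} (hB.mono hf0) fun h =>
    hne (funext fun i => (h ▸ Set.mem_univ i : i ∈ {i | f i = 0}))
  have := hzero i j
  simp only [Set.mem_ofPred_eq] at hi hj
  simp [hi, hj, hij.ne'] at this

/-- The Dirichlet problem is solvable for arbitrary boundary data on a nonempty set. -/
theorem exists_harmonic_extension (hnn : ∀ i j, 0 ≤ ω i j) (hsym : ∀ i j, ω i j = ω j i)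
    (hconn : ∀ A : Set S, A.Nonempty → A ≠ Set.univ → ∃ i ∈ A, ∃ j ∉ A, 0 < ω i j)
    {B : Set S} (hB : B.Nonempty) (g : S → ℝ) :
    ∃ f : S → ℝ, (∀ i ∈ B, f i = g i) ∧ ∀ i ∉ B, ∑ j, ω i j * (f j - f i) = 0 := by
  classical
  let L : (S → ℝ) →ₗ[ℝ] (S → ℝ) :=
    { toFun := fun f i => if i ∈ B then f i else ∑ j, ω i j * (f j - f i)
      map_add' := fun f f' => by
        ext i
        simp only [Pi.add_apply]
        split_ifs
        · rfl
        · rw [← Finset.sum_add_distrib]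
          congr! 1
          ring
      map_smul' := fun c f => by
        ext i
        simp only [Pi.smul_apply, smul_eq_mul, RingHom.id_apply]
        split_ifs
        · rfl
        · rw [Finset.mul_sum]
          congr! 1
          ring }
  have hL : ∀ f i, L f i = if i ∈ B then f i else ∑ j, ω i j * (f j - f i) := fun _ _ => rfl
  have hinj : Function.Injective L := by
    rw [injective_iff_map_eq_zero]
    intro f hf
    refine eq_zero_of_harmonic hnn hsym hconn hB (fun i hi => ?_) fun i hi => ?_
    · simpa [hL, hi] using congrFun hf i
    · simpa [hL, hi] using congrFun hf i
  obtain ⟨f, hf⟩ := LinearMap.surjective_of_injective hinj fun i => if i ∈ B then g i else 0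
  refine ⟨f, fun i hi => ?_, fun i hi => ?_⟩
  · simpa [hL, hi] using congrFun hf i
  · simpa [hL, hi] using congrFun hf i

/-- A function harmonic off `B` is the combination, with its values on `B` as coefficients, of
the harmonic extensions of the indicators of the points of `B`. -/
theorem eq_sum_smul_harmonic [DecidableEq S] (hnn : ∀ i j, 0 ≤ ω i j)
    (hsym : ∀ i j, ω i j = ω j i)
    (hconn : ∀ A : Set S, A.Nonempty → A ≠ Set.univ → ∃ i ∈ A, ∃ j ∉ A, 0 < ω i j)
    {B : Finset S} (hB : B.Nonempty) {h : S → S → ℝ}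
    (hb : ∀ k, ∀ i ∈ B, h k i = if i = k then 1 else 0)
    (hh : ∀ k, ∀ i ∉ B, ∑ j, ω i j * (h k j - h k i) = 0)
    {f : S → ℝ} (hf : ∀ i ∉ B, ∑ j, ω i j * (f j - f i) = 0) :
    f = ∑ k ∈ B, f k • h k := by
  rw [← sub_eq_zero]
  refine eq_zero_of_harmonic hnn hsym hconn (B := (B : Set S)) (by simpa using hB) ?_ ?_
  · intro i hi
    rw [Finset.mem_coe] at hi
    simp [hb _ i hi, hi]
  · intro i hi
    rw [Finset.mem_coe] at hi
    have expand : ∑ j, ω i j * ((f - ∑ k ∈ B, f k • h k) j - (f - ∑ k ∈ B, f k • h k) i)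
        = ∑ j, ω i j * (f j - f i) - ∑ k ∈ B, f k * ∑ j, ω i j * (h k j - h k i) := by
      simp_rw [Finset.mul_sum]
      rw [Finset.sum_comm, ← Finset.sum_sub_distrib]
      refine Finset.sum_congr rfl fun j _ => ?_
      simp only [Pi.sub_apply, Finset.sum_apply, Pi.smul_apply, smul_eq_mul]
      rw [sub_sub_sub_comm, ← Finset.sum_sub_distrib, mul_sub, Finset.mul_sum]
      congr! 2
      ring
    rw [expand, hf i hi]
    simp [hh _ i hi]

end

/-- A bilinear sum with symmetric coefficients and vanishing row sums is a sum over products of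
differences. -/
theorem sum_mul_eq_sum_sub_mul_sub {ι : Type*} (B : Finset ι) (c : ι → ι → ℝ)
    (hrow : ∀ i ∈ B, ∑ j ∈ B, c i j = 0) (hcomm : ∀ i j, c i j = c j i) (u v : ι → ℝ) :
    ∑ i ∈ B, ∑ j ∈ B, c i j * u i * v j
      = (1 / 2) * ∑ i ∈ B, ∑ j ∈ B, -c i j * (u i - u j) * (v i - v j) := by
  have diag : ∑ i ∈ B, ∑ j ∈ B, c i j * (u i * v i) = 0 :=
    Finset.sum_eq_zero fun i hi => by rw [← Finset.sum_mul, hrow i hi, zero_mul]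
  have diag' : ∑ i ∈ B, ∑ j ∈ B, c i j * (u j * v j) = 0 := by
    rw [Finset.sum_comm, ← diag]
    simp only [hcomm]
  have swap : ∑ i ∈ B, ∑ j ∈ B, c i j * u j * v i = ∑ i ∈ B, ∑ j ∈ B, c i j * u i * v j := by
    rw [Finset.sum_comm]
    simp only [hcomm]
  have expand : ∑ i ∈ B, ∑ j ∈ B, -c i j * (u i - u j) * (v i - v j)
      = ∑ i ∈ B, ∑ j ∈ B, c i j * u i * v j + ∑ i ∈ B, ∑ j ∈ B, c i j * u j * v i
        - ∑ i ∈ B, ∑ j ∈ B, c i j * (u i * v i) - ∑ i ∈ B, ∑ j ∈ B, c i j * (u j * v j) := by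
    simp only [← Finset.sum_add_distrib, ← Finset.sum_sub_distrib]
    congr! 2
    ring
  rw [expand, diag, diag', swap]
  ring

/-- first part of Lemma 5.9 / Lemma 4.3 of [RS]: for harmonic extensions
`ũ, ṽ` of `u, v : S⋆ → ℝ`, the Dirichlet form satisfies
`D(ũ, ṽ) = (1/2) Σ_{i,j∈S⋆} β_{i,j} (u(i)-u(j))(v(i)-v(j))`, where `β` is defined through
capacities. -/
theorem dirichlet_form_of_harmonic_extensions {S : Type*} [Fintype S] [DecidableEq S]
    (ω : S → S → ℝ) (hnn : ∀ i j, 0 ≤ ω i j) (hsym : ∀ i j, ω i j = ω j i)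
    (hdiag : ∀ i, ω i i = 0)
    (hconn : ∀ A : Set S, A.Nonempty → A ≠ Set.univ → ∃ i ∈ A, ∃ j ∉ A, 0 < ω i j)
    (Sstar : Set S) (hScard : 2 ≤ Sstar.ncard)
    (cap : Set S → Set S → ℝ)
    (hcap0 : ∀ A : Set S, cap A ∅ = 0)
    (hcap : ∀ A B : Set S, A.Nonempty → B.Nonempty → Disjoint A B →
        ∀ f : S → ℝ, (∀ i ∈ A, f i = 1) → (∀ i ∈ B, f i = 0) →
        (∀ i, i ∉ A ∪ B → ∑ j, ω i j * (f j - f i) = 0) →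
        cap A B = (1 / 2) * ∑ i, ∑ j, ω i j * (f i - f j) * (f i - f j))
    (ut vt : S → ℝ)
    (hu : ∀ i ∉ Sstar, ∑ j, ω i j * (ut j - ut i) = 0)
    (hv : ∀ i ∉ Sstar, ∑ j, ω i j * (vt j - vt i) = 0) :
    (1 / 2) * ∑ i, ∑ j, ω i j * (ut i - ut j) * (vt i - vt j)
      = (1 / 2) * ∑ᶠ i ∈ Sstar, ∑ᶠ j ∈ Sstar,
          (if i = j then 0 else
            (1 / 2) * (cap {i} (Sstar \ {i}) + cap {j} (Sstar \ {j})
              - cap {i, j} (Sstar \ {i, j})))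
            * (ut i - ut j) * (vt i - vt j) := by
  classical
  obtain ⟨B, rfl⟩ : ∃ B : Finset S, Sstar = B := ⟨Sstar.toFinset, by simp⟩
  simp only [Set.ncard_coe_finset, Finset.mem_coe] at hScard hu hv
  have hB : B.Nonempty := Finset.card_pos.1 (by omega)
  choose h hb hh using fun k : S =>
    exists_harmonic_extension hnn hsym hconn (B := (B : Set S)) (by simpa using hB)
      fun i => if i = k then 1 else 0
  simp only [Finset.mem_coe] at hb hh
  have expand : ∀ {f : S → ℝ}, (∀ i ∉ B, ∑ j, ω i j * (f j - f i) = 0) →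
      f = ∑ k ∈ B, f k • h k := eq_sum_smul_harmonic hnn hsym hconn hB hb hh
  have hone : (1 : S → ℝ) = ∑ k ∈ B, h k := by
    simpa using expand (f := 1) (by simp)
  have hrow : ∀ i ∈ B, ∑ j ∈ B, dirichletForm ω (h i) (h j) = 0 := fun i _ => by
    rw [← map_sum, ← hone, dirichletForm_one_right]
  have cap_single : ∀ i ∈ B, cap {i} (↑B \ {i}) = dirichletForm ω (h i) (h i) := by
    intro i hi
    obtain ⟨j, hj, hji⟩ := Finset.exists_mem_ne (by omega : 1 < B.card) i
    refine hcap _ _ (Set.singleton_nonempty i) ⟨j, by simp [hj, hji]⟩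
      Set.disjoint_sdiff_right (h i) ?_ ?_ ?_
    · rintro _ rfl
      simp [hb _ _ hi]
    · rintro k ⟨hk, hki⟩
      rw [hb i k hk, if_neg (by simpa using hki)]
    · intro k hk
      refine hh i k fun hkB => hk ?_
      by_cases hki : k = i <;> simp [hki, hkB]
  have cap_pair : ∀ i ∈ B, ∀ j ∈ B, i ≠ j →
      cap {i, j} (↑B \ {i, j}) = dirichletForm ω (h i + h j) (h i + h j) := by
    intro i hi j hj hij
    rcases ((B : Set S) \ {i, j}).eq_empty_or_nonempty with hempty | hne
    · have hBij : B = {i, j} := by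
        refine Finset.Subset.antisymm (fun k hk => ?_) (by simp [Finset.insert_subset_iff, hi, hj])
        simpa using Set.sdiff_eq_empty.1 hempty (Finset.mem_coe.2 hk)
      have hsum : h i + h j = 1 := by rw [hone, hBij, Finset.sum_pair hij]
      rw [hempty, hcap0, hsum, dirichletForm_one_right]
    · refine hcap _ _ ⟨i, by simp⟩ hne Set.disjoint_sdiff_right (h i + h j) ?_ ?_ ?_
      · rintro k (rfl | rfl)
        · simp [hb _ _ hi, hij]
        · simp [hb _ _ hj, hij.symm]
      · rintro k ⟨hk, hkij⟩
        simp only [Set.mem_insert_iff, Set.mem_singleton_iff, not_or] at hkij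
        simp [hb _ k hk, hkij]
      · intro k hk
        have hkB : k ∉ B := fun hkB => hk <| by
          by_cases hkij : k ∈ ({i, j} : Set S)
          · exact Or.inl hkij
          · exact Or.inr ⟨hkB, hkij⟩
        simp only [Pi.add_apply, add_sub_add_comm, mul_add, Finset.sum_add_distrib,
          hh _ k hkB, add_zero]
  have hD : dirichletForm ω ut vt
      = ∑ i ∈ B, ∑ j ∈ B, dirichletForm ω (h i) (h j) * ut i * vt j := by
    conv_lhs => rw [expand hu, expand hv]
    simp only [map_sum, map_smul, LinearMap.sum_apply, LinearMap.smul_apply, smul_eq_mul,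
      Finset.mul_sum]
    rw [Finset.sum_comm]
    congr! 2
    ring
  rw [← dirichletForm_apply, hD,
    sum_mul_eq_sum_sub_mul_sub B _ hrow (fun i j => dirichletForm_comm _ _) ut vt]
  simp only [Finset.mem_coe, finsum_mem_finset_eq_sum]
  congr 1
  refine Finset.sum_congr rfl fun i hi => Finset.sum_congr rfl fun j hj => ?_
  by_cases hij : i = j
  · simp [hij]
  · rw [if_neg hij, cap_single i hi, cap_single j hj, cap_pair i hi j hj hij]
    simp only [map_add, LinearMap.add_apply, dirichletForm_comm (h j) (h i)]
    ring
end

section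
/- Let H, L be d × d real matrices with H symmetric and invertible and HL skew-symmetric ((HL)ᵀ = −HL). Suppose e₁ ∈ ℝ^d satisfies H e₁ = −λ₁ e₁ with λ₁ ≠ 0, and v ∈ ℝ^d satisfies (H − Lᵀ) v = −μ v for some μ ∈ ℝ. Then ( v + L H^{−1} v ) · e₁ = (μ/λ₁) ( v · e₁ ). -/
open Matrix

/-- computation from the proof of Proposition `p_test` in the paper:
`(v + L H⁻¹ v) · e₁ = (μ/λ₁) (v · e₁)` for an eigenvector `e₁` of `H` with eigenvalue `-λ₁`
and an eigenvector `v` of `H - Lᵀ` with eigenvalue `-μ`. -/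
theorem eigenvector_inner_identity {d : ℕ} (H L : Matrix (Fin d) (Fin d) ℝ)
    (hsym : Hᵀ = H) (hinv : IsUnit H.det)
    (hskew : (H * L)ᵀ = -(H * L))
    (e₁ v : Fin d → ℝ) (lam₁ μ : ℝ) (hlam₁ : lam₁ ≠ 0)
    (he : H.mulVec e₁ = (-lam₁) • e₁)
    (hv : (H - Lᵀ).mulVec v = (-μ) • v) :
    (v + L.mulVec (H⁻¹.mulVec v)) ⬝ᵥ e₁ = (μ / lam₁) * (v ⬝ᵥ e₁) := by
  have hHL : H * L = -(Lᵀ * H) := by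
    rw [transpose_mul, hsym] at hskew
    rw [hskew, neg_neg]
  have hv_eq : H *ᵥ (H⁻¹ *ᵥ v) = v := by
    rw [mulVec_mulVec, mul_nonsing_inv H hinv, one_mulVec]
  have hHu : H *ᵥ (v + L *ᵥ (H⁻¹ *ᵥ v)) = (-μ) • v := by
    rw [mulVec_add, mulVec_mulVec _ H L, hHL, neg_mulVec, ← mulVec_mulVec, hv_eq,
      ← sub_eq_add_neg, ← sub_mulVec, hv]
  generalize v + L *ᵥ (H⁻¹ *ᵥ v) = u at hHu ⊢
  have hadj : u ⬝ᵥ (H *ᵥ e₁) = (H *ᵥ u) ⬝ᵥ e₁ := by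
    rw [dotProduct_mulVec, ← mulVec_transpose, hsym]
  rw [he, hHu, dotProduct_smul, smul_dotProduct, smul_eq_mul, smul_eq_mul] at hadj
  field_simp
  linarith
end

section
/- Let H be a d × d real symmetric matrix with orthonormal eigenbasis e₁, …, e_d, where H e₁ = −λ₁ e₁ with λ₁ > 0 and H e_k = λ_k e_k with λ_k > 0 for 2 ≤ k ≤ d (so −λ₁ is the unique negative eigenvalue of H). Let L be a d × d real matrix with HL skew-symmetric, let μ > 0, and let v be a unit vector with (H − Lᵀ) v = −μ v. Write v_k = v · e_k and ṽ = (v₂, …, v_d) ∈ ℝ^{d−1}, and let H̃ = diag(λ₂, …, λ_d). Then: (a) μ · (v · H^{−1} v) = −1, and consequently v₁ = v · e₁ ≠ 0; (b) the (d−1) × (d−1) matrix H̃ + μ ṽ ṽᵀ is positive definite and det( H̃ + μ ṽ ṽᵀ ) = (v · e₁)² (μ/λ₁) ∏_{k=2}^d λ_k. -/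
open Matrix
open scoped BigOperators

/-- The matrix determinant lemma for a rank-one perturbation of an invertible diagonal matrix. -/
theorem det_diagonal_add_smul_vecMulVec_self {n : Type*} [Fintype n] [DecidableEq n]
    (D a : n → ℝ) (hD : ∀ k, D k ≠ 0) (c : ℝ) :
    (Matrix.diagonal D + c • Matrix.vecMulVec a a).det
      = (∏ k, D k) * (1 + c * ∑ k, a k ^ 2 / D k) := by
  have hdet : (Matrix.diagonal D).det = ∏ k, D k := Matrix.det_diagonal
  have hu : IsUnit (Matrix.diagonal D).det := by
    rw [hdet, isUnit_iff_ne_zero]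
    exact Finset.prod_ne_zero_iff.mpr fun k _ => hD k
  have hinv : (Matrix.diagonal D)⁻¹ = Matrix.diagonal fun k => (D k)⁻¹ := by
    refine Matrix.inv_eq_right_inv ?_
    rw [Matrix.diagonal_mul_diagonal, ← Matrix.diagonal_one]
    congr 1
    funext k
    exact mul_inv_cancel₀ (hD k)
  rw [← Matrix.smul_vecMulVec, Matrix.vecMulVec_eq Unit,
    Matrix.det_add_replicateCol_mul_replicateRow hu, hdet, hinv]
  congr 1
  rw [Matrix.det_unique]
  simp [Matrix.mul_apply, Matrix.diagonal_apply, Finset.mul_sum]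
  refine Finset.sum_congr rfl fun k _ => ?_
  ring

/-- A real matrix with an orthonormal basis of eigenvectors `e i` and nonzero eigenvalues `D i`
is invertible, and the quadratic form of its inverse is diagonal in that basis. -/
theorem isUnit_det_and_dotProduct_inv_mulVec_of_orthonormal_eigenvectors
    {n : Type*} [Fintype n] [DecidableEq n]
    (H : Matrix n n ℝ) (e : n → n → ℝ)
    (horth : ∀ i j, e i ⬝ᵥ e j = if i = j then (1 : ℝ) else 0)
    (D : n → ℝ) (hD : ∀ i, D i ≠ 0) (he : ∀ i, H *ᵥ e i = D i • e i) (v : n → ℝ) :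
    IsUnit H.det ∧ v ⬝ᵥ H⁻¹ *ᵥ v = ∑ i, (v ⬝ᵥ e i) ^ 2 / D i := by
  set P : Matrix n n ℝ := Matrix.of e with hP
  have hPPt : P * Pᵀ = 1 := by
    ext i j
    rw [Matrix.one_apply, ← horth i j]
    rfl
  have hPtP : Pᵀ * P = 1 := mul_eq_one_comm.mp hPPt
  have hHP : H * Pᵀ = Pᵀ * Matrix.diagonal D := by
    ext i j
    rw [Matrix.mul_diagonal]
    have := congrFun (he j) i
    rw [Pi.smul_apply, smul_eq_mul, mul_comm] at this
    exact this
  have hright : H * (Pᵀ * Matrix.diagonal (fun i => (D i)⁻¹) * P) = 1 := by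
    rw [← mul_assoc, ← mul_assoc, hHP, mul_assoc Pᵀ, Matrix.diagonal_mul_diagonal]
    simp [hD, hPtP]
  refine ⟨Matrix.isUnit_det_of_right_inverse hright, ?_⟩
  rw [Matrix.inv_eq_right_inv hright, ← Matrix.mulVec_mulVec, ← Matrix.mulVec_mulVec,
    Matrix.dotProduct_mulVec, Matrix.vecMul_transpose]
  simp only [dotProduct, Matrix.mulVec_diagonal]
  refine Finset.sum_congr rfl fun i _ => ?_
  have : (P *ᵥ v) i = v ⬝ᵥ e i := dotProduct_comm _ _
  rw [this]
  simp only [dotProduct]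
  ring

/-- If `H` is symmetric and invertible and `H * L` is skew-symmetric, an eigenvector of `H - Lᵀ`
satisfies this identity between its norm and the quadratic form of `H⁻¹`. -/
theorem eigenvalue_mul_dotProduct_inv_mulVec {n : Type*} [Fintype n] [DecidableEq n]
    (H L : Matrix n n ℝ) (hsym : Hᵀ = H) (hdet : IsUnit H.det) (hskew : (H * L)ᵀ = -(H * L))
    (c : ℝ) (v : n → ℝ) (hv : (H - Lᵀ) *ᵥ v = c • v) :
    c * (v ⬝ᵥ H⁻¹ *ᵥ v) = v ⬝ᵥ v := by
  set w := H⁻¹ *ᵥ v with hw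
  have hHw : H *ᵥ w = v := by
    rw [hw, Matrix.mulVec_mulVec, Matrix.mul_nonsing_inv _ hdet, Matrix.one_mulVec]
  have hzero : w ⬝ᵥ Lᵀ *ᵥ v = 0 := by
    have h1 : w ⬝ᵥ Lᵀ *ᵥ v = w ⬝ᵥ (H * L)ᵀ *ᵥ w := by
      rw [Matrix.transpose_mul, hsym, ← Matrix.mulVec_mulVec, hHw]
    have h2 : w ⬝ᵥ (H * L)ᵀ *ᵥ w = w ⬝ᵥ (H * L) *ᵥ w := by
      rw [Matrix.dotProduct_mulVec, Matrix.vecMul_transpose, dotProduct_comm]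
    have h3 : w ⬝ᵥ (H * L)ᵀ *ᵥ w = -(w ⬝ᵥ (H * L) *ᵥ w) := by
      rw [hskew, Matrix.neg_mulVec, dotProduct_neg]
    linarith
  have hone : w ⬝ᵥ H *ᵥ v = v ⬝ᵥ v := by
    rw [Matrix.dotProduct_mulVec, ← Matrix.mulVec_transpose, hsym, hHw]
  have := congrArg (w ⬝ᵥ ·) hv
  simp only [Matrix.sub_mulVec, dotProduct_sub, dotProduct_smul, smul_eq_mul] at this
  rw [dotProduct_comm v w, ← this, hone, hzero, sub_zero]

/-- Lemmas 8.1, 8.2, 8.7 and 8.9 of the companion paper: properties of the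
unit eigenvector `v` of `H - Lᵀ` with eigenvalue `-μ`, and positive definiteness and determinant
of the reduced matrix `H̃ + μ ṽ ṽᵀ`. The ambient dimension is `d + 1`; `e 0` plays the role of
`e₁` and `e k.succ`, `k : Fin d`, are the remaining eigenvectors. -/
theorem reduced_matrix_properties {d : ℕ} (H L : Matrix (Fin (d + 1)) (Fin (d + 1)) ℝ)
    (hsym : Hᵀ = H)
    (e : Fin (d + 1) → Fin (d + 1) → ℝ)
    (horth : ∀ i j, e i ⬝ᵥ e j = if i = j then (1 : ℝ) else 0)
    (lam₁ : ℝ) (hlam₁ : 0 < lam₁) (lam : Fin d → ℝ) (hlam : ∀ k, 0 < lam k)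
    (he₁ : H.mulVec (e 0) = (-lam₁) • e 0)
    (hek : ∀ k : Fin d, H.mulVec (e k.succ) = lam k • e k.succ)
    (hskew : (H * L)ᵀ = -(H * L))
    (μ : ℝ) (hμ : 0 < μ)
    (v : Fin (d + 1) → ℝ) (hvunit : v ⬝ᵥ v = 1)
    (hv : (H - Lᵀ).mulVec v = (-μ) • v) :
    (μ * (v ⬝ᵥ H⁻¹.mulVec v) = -1 ∧ v ⬝ᵥ e 0 ≠ 0) ∧
    ((Matrix.diagonal lam +
        μ • Matrix.vecMulVec (fun k : Fin d => v ⬝ᵥ e k.succ) (fun k : Fin d => v ⬝ᵥ e k.succ)).PosDef ∧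
      (Matrix.diagonal lam +
        μ • Matrix.vecMulVec (fun k : Fin d => v ⬝ᵥ e k.succ) (fun k : Fin d => v ⬝ᵥ e k.succ)).det
        = (v ⬝ᵥ e 0) ^ 2 * (μ / lam₁) * ∏ k, lam k) := by
  have hD : ∀ i, (Fin.cons (-lam₁) lam : Fin (d + 1) → ℝ) i ≠ 0 :=
    Fin.cases (neg_ne_zero.mpr hlam₁.ne') fun k => (hlam k).ne'
  obtain ⟨hdet, hquad⟩ := isUnit_det_and_dotProduct_inv_mulVec_of_orthonormal_eigenvectors
    H e horth (Fin.cons (-lam₁) lam) hD (Fin.cases he₁ hek) v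
  have hform : μ * (v ⬝ᵥ H⁻¹ *ᵥ v) = -1 := by
    have := eigenvalue_mul_dotProduct_inv_mulVec H L hsym hdet hskew (-μ) v hv
    linarith
  simp only [Fin.sum_univ_succ, Fin.cons_zero, Fin.cons_succ] at hquad
  have hsum : 1 + μ * ∑ k : Fin d, (v ⬝ᵥ e k.succ) ^ 2 / lam k
      = (v ⬝ᵥ e 0) ^ 2 * (μ / lam₁) := by
    have h := hform
    rw [hquad, div_neg] at h
    linear_combination h
  have hnonneg : 0 ≤ ∑ k : Fin d, (v ⬝ᵥ e k.succ) ^ 2 / lam k :=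
    Finset.sum_nonneg fun k _ => div_nonneg (sq_nonneg _) (hlam k).le
  refine ⟨⟨hform, fun h0 => ?_⟩, ?_, ?_⟩
  · rw [h0] at hsum
    have := mul_nonneg hμ.le hnonneg
    simp at hsum
    linarith
  · refine (Matrix.PosDef.diagonal hlam).add_posSemidef (Matrix.PosSemidef.smul ?_ hμ.le)
    simpa using Matrix.posSemidef_vecMulVec_self_star fun k : Fin d => v ⬝ᵥ e k.succ
  · rw [det_diagonal_add_smul_vecMulVec_self _ _ (fun k => (hlam k).ne'), hsum, mul_comm]
end

section
/- Let H be a d × d real symmetric matrix with orthonormal eigenbasis e₁, …, e_d, where H e₁ = −λ₁ e₁ with λ₁ > 0 and H e_k = λ_k e_k with λ_k > 0 for 2 ≤ k ≤ d. Let L be a d × d real matrix with HL skew-symmetric, let μ > 0, and let v be a unit vector with (H − Lᵀ) v = −μ v; write v_k = v · e_k (so v₁ ≠ 0), ṽ = (v₂, …, v_d), H̃ = diag(λ₂, …, λ_d). Fix a real number s and define γ = (γ₂, …, γ_d) ∈ ℝ^{d−1} by γ_k = (v_k / v₁) (λ₁^{1/2} / λ_k) s. Then for every x ∈ ℝ^d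 whose coordinates x_k = x · e_k satisfy x₁ = s / λ₁^{1/2}, one has x · (H + μ v vᵀ) x = (x̃ + γ) · (H̃ + μ ṽ ṽᵀ) (x̃ + γ), where x̃ = (x₂, …, x_d) ∈ ℝ^{d−1}. -/
open Matrix

/-- Parseval's identity for an orthonormal family of full size. -/
theorem dotProduct_eq_sum_of_orthonormal {n : Type*} [Fintype n] [DecidableEq n]
    (e : n → n → ℝ) (horth : ∀ i j, e i ⬝ᵥ e j = if i = j then (1 : ℝ) else 0)
    (x y : n → ℝ) : x ⬝ᵥ y = ∑ i, (x ⬝ᵥ e i) * (y ⬝ᵥ e i) := by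
  have hE : Matrix.of e * (Matrix.of e)ᵀ = 1 := by
    ext i j
    simpa [Matrix.mul_apply, Matrix.one_apply, dotProduct] using horth i j
  have hE' : (Matrix.of e)ᵀ * Matrix.of e = 1 := mul_eq_one_comm.mp hE
  calc x ⬝ᵥ y = x ⬝ᵥ ((Matrix.of e)ᵀ * Matrix.of e) *ᵥ y := by rw [hE', one_mulVec]
    _ = (Matrix.of e *ᵥ x) ⬝ᵥ (Matrix.of e *ᵥ y) := by
      rw [← mulVec_mulVec, dotProduct_mulVec, vecMul_transpose]
    _ = ∑ i, (x ⬝ᵥ e i) * (y ⬝ᵥ e i) := by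
      refine Finset.sum_congr rfl fun i _ => ?_
      rw [dotProduct_comm x, dotProduct_comm y]
      rfl

/-- A symmetric matrix can be moved across the dot product. -/
theorem mulVec_dotProduct_of_transpose_eq {n : Type*} [Fintype n] {H : Matrix n n ℝ}
    (hsym : Hᵀ = H) (x y : n → ℝ) : (H *ᵥ x) ⬝ᵥ y = x ⬝ᵥ H *ᵥ y := by
  rw [dotProduct_mulVec, ← mulVec_transpose, hsym]

/-- The quadratic form of a skew-symmetric matrix vanishes. -/
theorem dotProduct_mulVec_self_of_transpose_eq_neg {n : Type*} [Fintype n] {A : Matrix n n ℝ}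
    (hA : Aᵀ = -A) (w : n → ℝ) : w ⬝ᵥ A *ᵥ w = 0 := by
  have h : w ⬝ᵥ A *ᵥ w = -(w ⬝ᵥ A *ᵥ w) := by
    conv_lhs => rw [dotProduct_mulVec, ← mulVec_transpose, hA, neg_mulVec, neg_dotProduct,
      dotProduct_comm]
  linarith

/-- If `H L` is skew-symmetric and `v = H w` is a unit vector with `(H - Lᵀ) v = -μ v`, then
`μ (w · v) = -1`. -/
theorem mul_dotProduct_eq_neg_one_of_skew {n : Type*} [Fintype n] {H L : Matrix n n ℝ}
    (hsym : Hᵀ = H) (hskew : (H * L)ᵀ = -(H * L)) {μ : ℝ} {v w : n → ℝ}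
    (hw : H *ᵥ w = v) (hvunit : v ⬝ᵥ v = 1) (hv : (H - Lᵀ) *ᵥ v = (-μ) • v) :
    μ * (w ⬝ᵥ v) = -1 := by
  have hL : w ⬝ᵥ Lᵀ *ᵥ v = 0 := by
    have hLH : Lᵀ * H = -(H * L) := by rw [← hskew, transpose_mul, hsym]
    rw [← hw, mulVec_mulVec, hLH, neg_mulVec, dotProduct_neg,
      dotProduct_mulVec_self_of_transpose_eq_neg hskew, neg_zero]
  have h := congrArg (fun u => w ⬝ᵥ u) hv
  simp only [sub_mulVec, dotProduct_sub, dotProduct_smul, smul_eq_mul, hL,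
    ← mulVec_dotProduct_of_transpose_eq hsym, hw, hvunit] at h
  linarith

/-- The quadratic form of `H + μ u uᵀ`. -/
theorem dotProduct_add_smul_vecMulVec_mulVec {n : Type*} [Fintype n] (H : Matrix n n ℝ) (μ : ℝ)
    (u x : n → ℝ) :
    x ⬝ᵥ (H + μ • vecMulVec u u) *ᵥ x = x ⬝ᵥ H *ᵥ x + μ * (u ⬝ᵥ x) ^ 2 := by
  rw [add_mulVec, smul_mulVec, vecMulVec_mulVec, dotProduct_add, dotProduct_smul]
  rw [op_smul_eq_smul, dotProduct_smul, dotProduct_comm x u, smul_eq_mul, smul_eq_mul, sq]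

/-- Lemma 7.3 / Lemmas 8.7–8.9 of the companion paper: the change of
coordinates identity `x · (H + μ v vᵀ) x = (x̃ + γ) · (H̃ + μ ṽ ṽᵀ) (x̃ + γ)` on the hyperplane
`x₁ = s/λ₁^{1/2}`. The ambient dimension is `d + 1`; `e 0` plays the role of `e₁`. -/
theorem change_of_coordinates {d : ℕ} (H L : Matrix (Fin (d + 1)) (Fin (d + 1)) ℝ)
    (hsym : Hᵀ = H)
    (e : Fin (d + 1) → Fin (d + 1) → ℝ)
    (horth : ∀ i j, e i ⬝ᵥ e j = if i = j then (1 : ℝ) else 0)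
    (lam₁ : ℝ) (hlam₁ : 0 < lam₁) (lam : Fin d → ℝ) (hlam : ∀ k, 0 < lam k)
    (he₁ : H.mulVec (e 0) = (-lam₁) • e 0)
    (hek : ∀ k : Fin d, H.mulVec (e k.succ) = lam k • e k.succ)
    (hskew : (H * L)ᵀ = -(H * L))
    (μ : ℝ) (hμ : 0 < μ)
    (v : Fin (d + 1) → ℝ) (hvunit : v ⬝ᵥ v = 1)
    (hv : (H - Lᵀ).mulVec v = (-μ) • v)
    (hv₁ : v ⬝ᵥ e 0 ≠ 0)
    (s : ℝ) :
    ∀ x : Fin (d + 1) → ℝ, x ⬝ᵥ e 0 = s / Real.sqrt lam₁ →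
      x ⬝ᵥ (H + μ • Matrix.vecMulVec v v).mulVec x
        = (fun k : Fin d =>
              x ⬝ᵥ e k.succ + (v ⬝ᵥ e k.succ / (v ⬝ᵥ e 0)) * (Real.sqrt lam₁ / lam k) * s)
          ⬝ᵥ (Matrix.diagonal lam +
                μ • Matrix.vecMulVec (fun k : Fin d => v ⬝ᵥ e k.succ)
                  (fun k : Fin d => v ⬝ᵥ e k.succ)).mulVec
              (fun k : Fin d =>
                x ⬝ᵥ e k.succ + (v ⬝ᵥ e k.succ / (v ⬝ᵥ e 0)) * (Real.sqrt lam₁ / lam k) * s) := by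
  intro x hx
  have parseval := dotProduct_eq_sum_of_orthonormal e horth
  set w : Fin (d + 1) → ℝ :=
    (-(v ⬝ᵥ e 0) / lam₁) • e 0 + ∑ k : Fin d, (v ⬝ᵥ e k.succ / lam k) • e k.succ with hwdef
  have hwe₁ : w ⬝ᵥ e 0 = -(v ⬝ᵥ e 0) / lam₁ := by
    simp [hwdef, add_dotProduct, sum_dotProduct, horth]
  have hwe (k : Fin d) : w ⬝ᵥ e k.succ = v ⬝ᵥ e k.succ / lam k := by
    simp [hwdef, add_dotProduct, sum_dotProduct, horth, (Fin.succ_ne_zero _).symm]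
  have hw : H *ᵥ w = v := by
    refine dotProduct_eq _ _ fun y => ?_
    rw [parseval (H *ᵥ w), parseval v]
    refine Finset.sum_congr rfl fun i _ => ?_
    congr 1
    rw [mulVec_dotProduct_of_transpose_eq hsym]
    refine Fin.cases ?_ (fun k => ?_) i
    · rw [he₁, dotProduct_smul, hwe₁, smul_eq_mul]
      field_simp
    · rw [hek, dotProduct_smul, hwe, smul_eq_mul, mul_div_cancel₀ _ (hlam k).ne']
  have hμw := mul_dotProduct_eq_neg_one_of_skew hsym hskew hw hvunit hv
  rw [parseval w, Fin.sum_univ_succ, hwe₁] at hμw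
  simp only [hwe] at hμw
  have hH : x ⬝ᵥ H *ᵥ x
      = -lam₁ * (x ⬝ᵥ e 0) ^ 2 + ∑ k : Fin d, lam k * (x ⬝ᵥ e k.succ) ^ 2 := by
    rw [parseval x (H *ᵥ x), Fin.sum_univ_succ]
    simp only [mulVec_dotProduct_of_transpose_eq hsym, he₁, hek, dotProduct_smul, smul_eq_mul]
    congr 1
    · ring
    · exact Finset.sum_congr rfl fun k _ => by ring
  rw [dotProduct_add_smul_vecMulVec_mulVec, dotProduct_add_smul_vecMulVec_mulVec, hH,
    parseval v x, Fin.sum_univ_succ, hx]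
  set r := Real.sqrt lam₁
  have hr : 0 < r := Real.sqrt_pos.mpr hlam₁
  have hr2 : lam₁ = r ^ 2 := (Real.sq_sqrt hlam₁.le).symm
  set a := v ⬝ᵥ e 0
  set A := ∑ k : Fin d, v ⬝ᵥ e k.succ / lam k * (v ⬝ᵥ e k.succ) with hA
  set P := ∑ k : Fin d, v ⬝ᵥ e k.succ * (x ⬝ᵥ e k.succ) with hP
  have hlin : (fun k : Fin d => v ⬝ᵥ e k.succ) ⬝ᵥ
      (fun k : Fin d => x ⬝ᵥ e k.succ + (v ⬝ᵥ e k.succ / a) * (r / lam k) * s)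
      = P + r * s / a * A := by
    rw [hP, hA, Finset.mul_sum, ← Finset.sum_add_distrib]
    exact Finset.sum_congr rfl fun k _ => by ring
  have hquad : (fun k : Fin d => x ⬝ᵥ e k.succ + (v ⬝ᵥ e k.succ / a) * (r / lam k) * s) ⬝ᵥ
      diagonal lam *ᵥ
        (fun k : Fin d => x ⬝ᵥ e k.succ + (v ⬝ᵥ e k.succ / a) * (r / lam k) * s)
      = (∑ k : Fin d, lam k * (x ⬝ᵥ e k.succ) ^ 2) + 2 * (r * s / a) * P
        + (r * s / a) ^ 2 * A := by
    rw [hP, hA, Finset.mul_sum, Finset.mul_sum, ← Finset.sum_add_distrib,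
      ← Finset.sum_add_distrib]
    refine Finset.sum_congr rfl fun k _ => ?_
    have := (hlam k).ne'
    rw [mulVec_diagonal]
    field_simp
    ring
  have hAval : A = a ^ 2 / r ^ 2 - 1 / μ := by
    rw [hr2] at hμw
    field_simp at hμw ⊢
    linarith
  rw [hlin, hquad, hAval, hr2]
  field_simp
  ring
end
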